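/- arXiv:2409.13307 — 4 statements merged into one kernel-verified Lean document; each statement's English description precedes it below -/
import Mathlib

section
/- Let q ∈ ℚ be the rational number equal to det B_p(k). Then the p-adic valuation of q equals −(n−2). -/
theorem PadicInt.isUnit_iff_toZMod_ne_zero {p : ℕ} [Fact p.Prime] {x : ℤ_[p]} :
    IsUnit x ↔ PadicInt.toZMod x ≠ 0 := by
  rw [← not_iff_not, not_not, ← mem_nonunits_iff, ← IsLocalRing.mem_maximalIdeal,
    ← PadicInt.ker_toZMod, RingHom.mem_ker]

theorem PadicInt.norm_lt_one_iff_toZMod_eq_zero {p : ℕ} [Fact p.Prime] {x : ℤ_[p]} :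
    ‖x‖ < 1 ↔ PadicInt.toZMod x = 0 := by
  rw [← RingHom.mem_ker, PadicInt.ker_toZMod, IsLocalRing.mem_maximalIdeal,
    PadicInt.mem_nonunits]

open Polynomial in
theorem PadicInt.exists_pow_eq_one_toZMod_eq {p : ℕ} [Fact p.Prime] (g : (ZMod p)ˣ) :
    ∃ u : ℤ_[p], u ^ (p - 1) = 1 ∧ PadicInt.toZMod u = g := by
  obtain ⟨a, ha⟩ := ZMod.ringHom_surjective (PadicInt.toZMod (p := p)) (g : ZMod p)
  let F : ℤ_[p][X] := X ^ (p - 1) - 1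
  have hF' : ‖F.derivative.aeval a‖ = 1 := by
    rw [← PadicInt.isUnit_iff, PadicInt.isUnit_iff_toZMod_ne_zero]
    have hp1 : 1 ≤ p := (Fact.out : p.Prime).one_le
    have hga : (g : ZMod p) ^ (p - 1 - 1) ≠ 0 := pow_ne_zero _ g.ne_zero
    simp [F, derivative_X_pow, ha, Nat.cast_sub hp1, hga]
  have hF : ‖F.aeval a‖ < 1 := by
    rw [PadicInt.norm_lt_one_iff_toZMod_eq_zero]
    simp [F, ha, ZMod.pow_card_sub_one_eq_one]
  obtain ⟨z, hz, hza, -⟩ := hensels_lemma (F := F) (a := a) (by rw [hF']; simpa using hF)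
  refine ⟨z, by simpa [F, sub_eq_zero] using hz, ?_⟩
  rw [hF', PadicInt.norm_lt_one_iff_toZMod_eq_zero, map_sub, sub_eq_zero, ha] at hza
  exact hza

/-- The Teichmüller character. -/
theorem PadicInt.exists_mulChar_toZMod_eq (p : ℕ) [Fact p.Prime] :
    ∃ ω : MulChar (ZMod p) ℤ_[p], ∀ x, PadicInt.toZMod (ω x) = x := by
  obtain ⟨g, hg⟩ := IsCyclic.exists_generator (α := (ZMod p)ˣ)
  obtain ⟨u, hu, hug⟩ := PadicInt.exists_pow_eq_one_toZMod_eq g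
  have hp0 : p - 1 ≠ 0 := Nat.sub_ne_zero_of_lt (Fact.out : p.Prime).one_lt
  let v : ℤ_[p]ˣ := Units.ofPowEqOne u (p - 1) hu hp0
  have hv : v ∈ rootsOfUnity (Fintype.card (ZMod p)ˣ) ℤ_[p] := by
    rw [mem_rootsOfUnity, ZMod.card_units, Units.pow_ofPowEqOne]
  have key : (MulChar.ofRootOfUnity hv hg).ringHomComp PadicInt.toZMod =
      MulChar.ofUnitHom (MonoidHom.id _) := by
    rw [MulChar.eq_iff hg, MulChar.ringHomComp_apply, MulChar.ofRootOfUnity_spec]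
    simp [v, hug]
  refine ⟨MulChar.ofRootOfUnity hv hg, fun x => ?_⟩
  have hx := congrArg (fun ψ : MulChar (ZMod p) (ZMod p) => ψ x) key
  rw [MulChar.ringHomComp_apply] at hx
  rw [hx]
  by_cases h : IsUnit x
  · obtain ⟨y, rfl⟩ := h
    simp
  · rw [MulChar.map_nonunit _ h, eq_comm]
    simpa using h

theorem ZMod.sum_pow_eq_ite (p : ℕ) [Fact p.Prime] {i : ℕ} (hi : i ≠ 0) :
    ∑ x : ZMod p, x ^ i = if p - 1 ∣ i then -1 else 0 := by
  have h := FiniteField.sum_pow_units (ZMod p) i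
  rw [ZMod.card] at h
  rw [← h, ← Fintype.sum_subtype_add_sum_subtype (fun x : ZMod p => x ≠ 0)]
  have h0 : ∑ x : {x : ZMod p // ¬ x ≠ 0}, (x : ZMod p) ^ i = 0 :=
    Finset.sum_eq_zero fun x _ => by rw [not_not.1 x.2, zero_pow hi]
  rw [h0, add_zero]
  exact (Fintype.sum_equiv unitsEquivNeZero _ _ fun x => rfl).symm

theorem ZMod.sum_pow_mul_one_sub_pow_ne_zero (p : ℕ) [Fact p.Prime] {a b : ℕ}
    (ha : a < p - 1) (hb : b < p - 1) (hab : p - 1 ≤ a + b) :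
    ∑ x : ZMod p, x ^ a * (1 - x) ^ b ≠ 0 := by
  have h : ∑ x : ZMod p, x ^ a * (1 - x) ^ b =
      ∑ m ∈ Finset.range (b + 1), (-1) ^ m * (b.choose m : ZMod p) *
        ∑ x : ZMod p, x ^ (a + m) := by
    simp_rw [Finset.mul_sum]
    rw [Finset.sum_comm]
    refine Finset.sum_congr rfl fun x _ => ?_
    rw [sub_eq_neg_add, add_pow, Finset.mul_sum]
    refine Finset.sum_congr rfl fun m _ => ?_
    rw [neg_pow]
    ring
  rw [h, Finset.sum_eq_single (p - 1 - a)]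
  · rw [ZMod.sum_pow_eq_ite p (by omega), if_pos (by rw [Nat.add_sub_cancel' ha.le])]
    simp only [ne_eq, mul_eq_zero, pow_eq_zero_iff', neg_eq_zero, one_ne_zero, false_and, false_or,
      or_false]
    rw [ZMod.natCast_eq_zero_iff]
    intro hd
    have hle : p - 1 - a ≤ b := by omega
    have hbp : b < p := by omega
    exact absurd (((Fact.out : p.Prime).dvd_factorial.1
      ((hd.mul_right _).mul_right _ |>.trans
        (Nat.choose_mul_factorial_mul_factorial hle).dvd))) (by omega)
  · intro m hm hne
    rw [Finset.mem_range] at hm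
    rw [ZMod.sum_pow_eq_ite p (by omega), if_neg, mul_zero]
    rintro ⟨c, hc⟩
    have hc2 : c < 2 := by
      by_contra! h2
      have := Nat.mul_le_mul_left (p - 1) h2
      omega
    interval_cases c <;> omega
  · intro hm
    rw [Finset.mem_range] at hm
    omega

section Teichmuller

variable {p : ℕ} [Fact p.Prime] {ω : MulChar (ZMod p) ℤ_[p]}

theorem isUnit_jacobiSum_pow_of_le_add (hω : ∀ x, PadicInt.toZMod (ω x) = x) {a b : ℕ}
    (ha : a < p - 1) (hb : b < p - 1) (hab : p - 1 ≤ a + b) :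
    IsUnit (jacobiSum (ω ^ a) (ω ^ b)) := by
  rw [PadicInt.isUnit_iff_toZMod_ne_zero, jacobiSum, map_sum]
  convert ZMod.sum_pow_mul_one_sub_pow_ne_zero p ha hb hab using 3 with x
  rw [map_mul, MulChar.pow_apply' _ (by omega), MulChar.pow_apply' _ (by omega), map_pow, map_pow,
    hω, hω]

theorem orderOf_of_toZMod_eq (hω : ∀ x, PadicInt.toZMod (ω x) = x) : orderOf ω = p - 1 := by
  obtain ⟨g, hg⟩ := IsCyclic.exists_generator (α := (ZMod p)ˣ)
  have hp0 : p - 1 ≠ 0 := Nat.sub_ne_zero_of_lt (Fact.out : p.Prime).one_lt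
  refine Nat.dvd_antisymm ?_ ?_
  · rw [orderOf_dvd_iff_pow_eq_one, ← ZMod.card_units p, MulChar.pow_card_eq_one]
  · have hgo : orderOf g = p - 1 := by
      rw [orderOf_eq_card_of_forall_mem_zpowers hg, Nat.card_eq_fintype_card, ZMod.card_units]
    rw [← hgo, orderOf_dvd_iff_pow_eq_one, Units.ext_iff]
    have h := congrArg (fun ψ : MulChar (ZMod p) ℤ_[p] => PadicInt.toZMod (ψ g))
      (pow_orderOf_eq_one ω)
    simpa only [MulChar.pow_apply_coe, map_pow, hω, MulChar.one_apply_coe, map_one,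
      Units.val_pow_eq_pow_val, Units.val_one] using h

theorem exists_isUnit_natCast_mul_inv_jacobiSum (hω : ∀ x, PadicInt.toZMod (ω x) = x) {a b : ℕ}
    (ha : 0 < a) (hb : 0 < b) (hab : a + b < p - 1) :
    ∃ v : ℤ_[p], IsUnit v ∧ (p : ℚ_[p]) * ((jacobiSum (ω ^ a) (ω ^ b) : ℤ_[p]) : ℚ_[p])⁻¹ = v := by
  refine ⟨jacobiSum (ω ^ (p - 1 - a)) (ω ^ (p - 1 - b)),
    isUnit_jacobiSum_pow_of_le_add hω (by omega) (by omega) (by omega), ?_⟩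
  let f : ℤ_[p] →+* ℚ_[p] := PadicInt.Coe.ringHom
  have hf : Function.Injective f := Subtype.val_injective
  have hord := orderOf_of_toZMod_eq hω
  have hne : ∀ c, 0 < c → c < p - 1 → (ω ^ c).ringHomComp f ≠ 1 := fun c h0 hc =>
    (MulChar.ringHomComp_ne_one_iff hf).2 (pow_ne_one_of_lt_orderOf h0.ne' (hord ▸ hc))
  have hinv : ∀ c < p - 1, ((ω ^ c).ringHomComp f)⁻¹ = (ω ^ (p - 1 - c)).ringHomComp f := by
    intro c hc
    rw [inv_eq_iff_mul_eq_one, ← MulChar.ringHomComp_mul, ← pow_add, Nat.add_sub_cancel' hc.le,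
      ← hord, pow_orderOf_eq_one, MulChar.ringHomComp_one]
  have key := jacobiSum_mul_jacobiSum_inv (F := ZMod p) (F' := ℚ_[p])
    (χ := (ω ^ a).ringHomComp f) (φ := (ω ^ b).ringHomComp f)
    (by
      rw [ringChar.eq_zero, ZMod.ringChar_zmod_n]
      exact (Fact.out : p.Prime).ne_zero.symm)
    (hne a ha (by omega)) (hne b hb (by omega))
    (by rw [← MulChar.ringHomComp_mul, ← pow_add]; exact hne _ (by omega) hab)
  rw [hinv a (by omega), hinv b (by omega), jacobiSum_ringHomComp, jacobiSum_ringHomComp,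
    ZMod.card] at key
  have hp0 : (p : ℚ_[p]) ≠ 0 := Nat.cast_ne_zero.2 (Fact.out : p.Prime).ne_zero
  have hJ : f (jacobiSum (ω ^ a) (ω ^ b)) ≠ 0 := fun h => hp0 (by rw [← key, h, zero_mul])
  change (p : ℚ_[p]) * (f (jacobiSum (ω ^ a) (ω ^ b)))⁻¹ =
    f (jacobiSum (ω ^ (p - 1 - a)) (ω ^ (p - 1 - b)))
  rw [mul_inv_eq_iff_eq_mul₀ hJ, ← key, mul_comm]

end Teichmuller

/-- A square matrix whose rows, after moving the last row to the top and reversing the columns,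
form an upper triangular matrix with nonzero diagonal. -/
theorem Matrix.det_ne_zero_of_antitriangular {F : Type*} [Field F] {m : ℕ}
    (C : Matrix (Fin (m + 1)) (Fin (m + 1)) F)
    (hzero : ∀ (i : Fin m) (j : Fin (m + 1)), m ≤ i.1 + j.1 → C i.castSucc j = 0)
    (hdiag : ∀ (i : Fin m) (j : Fin (m + 1)), i.1 + j.1 + 1 = m → C i.castSucc j ≠ 0)
    (hlast : C (Fin.last m) (Fin.last m) ≠ 0) : C.det ≠ 0 := by
  rw [← isUnit_iff_ne_zero, ← Matrix.isUnit_iff_isUnit_det,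
    ← Matrix.isUnit_submatrix_equiv (finRotate (m + 1)).symm Fin.revPerm,
    Matrix.isUnit_iff_isUnit_det, isUnit_iff_ne_zero]
  have h0 : (finRotate (m + 1)).symm 0 = Fin.last m := by
    rw [Equiv.symm_apply_eq, finRotate_last]
  have hs : ∀ i : Fin m, (finRotate (m + 1)).symm i.succ = i.castSucc := fun i => by
    rw [Equiv.symm_apply_eq, Fin.ext_iff, coe_finRotate_of_ne_last (Fin.castSucc_lt_last i).ne]
    rfl
  rw [Matrix.det_of_isUpperTriangular, Finset.prod_ne_zero_iff]
  · intro i _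
    refine Fin.cases ?_ (fun i => ?_) i
    · simpa [h0] using hlast
    · rw [Matrix.submatrix_apply, hs]
      exact hdiag _ _ (by simp [Fin.val_rev]; omega)
  · intro i j hij
    revert hij
    refine Fin.cases ?_ (fun i => ?_) i
    · intro hij
      exact absurd hij (Fin.not_lt_zero _)
    · intro hij
      have hij' : j < i.succ := hij
      rw [Fin.lt_def, Fin.val_succ] at hij'
      rw [Matrix.submatrix_apply, hs]
      exact hzero _ _ (by simp [Fin.val_rev]; omega)

theorem MulChar.isPrimitiveRoot_apply_generator {M R : Type*} [CommMonoid M] [CommRing R]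
    {g : Mˣ} (hg : ∀ x, x ∈ Subgroup.zpowers g) (χ : MulChar M R) :
    IsPrimitiveRoot (χ g) (orderOf χ) := by
  have h : ∀ n, χ ^ n = 1 ↔ χ g ^ n = 1 := fun n => by
    rw [MulChar.eq_iff hg, MulChar.pow_apply_coe, MulChar.one_apply_coe]
  exact ⟨(h _).1 (pow_orderOf_eq_one χ), fun l hl => orderOf_dvd_of_pow_eq_one ((h l).2 hl)⟩

theorem MulChar.orderOf_eq_of_forall_eq_pow {p : ℕ} [Fact p.Prime] {χ : MulChar (ZMod p) ℂ}
    (hχ : ∀ ψ : MulChar (ZMod p) ℂ, ∃ m : ℕ, ψ = χ ^ m) : orderOf χ = p - 1 := by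
  have hp0 : p - 1 ≠ 0 := Nat.sub_ne_zero_of_lt (Fact.out : p.Prime).one_lt
  refine Nat.dvd_antisymm ?_ ?_
  · rw [orderOf_dvd_iff_pow_eq_one, ← ZMod.card_units p, MulChar.pow_card_eq_one]
  · obtain ⟨ψ, hψ⟩ := MulChar.exists_mulChar_orderOf (ZMod p) (n := p - 1)
      (by rw [ZMod.card]) (Complex.isPrimitiveRoot_exp (p - 1) hp0)
    obtain ⟨m, rfl⟩ := hχ ψ
    exact hψ ▸ orderOf_pow_dvd m

/-- Two characters of the same order `p - 1`, with values in two fields of characteristic zero,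
come from a common character with values in a cyclotomic field. -/
theorem MulChar.exists_eq_ringHomComp {p : ℕ} [Fact p.Prime] {E F : Type*} [Field E] [CharZero E]
    [Field F] [CharZero F] {χ : MulChar (ZMod p) E} {φ : MulChar (ZMod p) F}
    (hχ : orderOf χ = p - 1) (hφ : orderOf φ = p - 1) :
    ∃ (ψ : MulChar (ZMod p) (CyclotomicField (p - 1) ℚ)) (f : CyclotomicField (p - 1) ℚ →+* E)
      (g : CyclotomicField (p - 1) ℚ →+* F), ψ.ringHomComp f = χ ∧ ψ.ringHomComp g = φ := by
  have hp0 : 0 < p - 1 := Nat.sub_pos_of_lt (Fact.out : p.Prime).one_lt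
  have : NeZero (p - 1) := ⟨hp0.ne'⟩
  have : IsCyclotomicExtension {p - 1} ℚ (CyclotomicField (p - 1) ℚ) := by
    rw [Subsingleton.elim (DivisionRing.toRatAlgebra (R := CyclotomicField (p - 1) ℚ))
      (CyclotomicField.algebra (p - 1) ℚ)]
    exact CyclotomicField.isCyclotomicExtension (p - 1) ℚ
  obtain ⟨g, hg⟩ := IsCyclic.exists_generator (α := (ZMod p)ˣ)
  have hζ := IsCyclotomicExtension.zeta_spec (p - 1) ℚ (CyclotomicField (p - 1) ℚ)
  have hirr := Polynomial.cyclotomic.irreducible_rat hp0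
  have hE : χ g ∈ primitiveRoots (p - 1) E :=
    (mem_primitiveRoots hp0).2 (hχ ▸ χ.isPrimitiveRoot_apply_generator hg)
  have hF : φ g ∈ primitiveRoots (p - 1) F :=
    (mem_primitiveRoots hp0).2 (hφ ▸ φ.isPrimitiveRoot_apply_generator hg)
  have hv : (hζ.isUnit hp0.ne').unit ∈
      rootsOfUnity (Fintype.card (ZMod p)ˣ) (CyclotomicField (p - 1) ℚ) := by
    rw [mem_rootsOfUnity, ZMod.card_units, Units.ext_iff]
    exact hζ.pow_eq_one
  refine ⟨MulChar.ofRootOfUnity hv hg,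
    (hζ.embeddingsEquivPrimitiveRoots E hirr).symm ⟨_, hE⟩,
    (hζ.embeddingsEquivPrimitiveRoots F hirr).symm ⟨_, hF⟩, ?_, ?_⟩ <;>
  · rw [MulChar.eq_iff hg, MulChar.ringHomComp_apply, MulChar.ofRootOfUnity_spec, IsUnit.unit_spec,
      RingHom.coe_coe, ← IsPrimitiveRoot.embeddingsEquivPrimitiveRoots_apply_coe hζ _ hirr,
      Equiv.apply_symm_apply]

/-- The valuation of the determinant of inverse Jacobi sums of powers of the Teichmüller
character. -/
theorem valuation_det_inv_jacobiSum {p k n : ℕ} [Fact p.Prime] {ω : MulChar (ZMod p) ℤ_[p]}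
    (hω : ∀ x, PadicInt.toZMod (ω x) = x) (hkn : k * (n + 2) = p - 1) :
    Padic.valuation (Matrix.det (Matrix.of fun i j : Fin (n + 1) =>
      ((jacobiSum (ω ^ (k * (i.1 + 1))) (ω ^ (k * (j.1 + 1))) : ℤ_[p]) : ℚ_[p])⁻¹)) = -(n : ℤ) := by
  have hp0 : (p : ℚ_[p]) ≠ 0 := Nat.cast_ne_zero.2 (Fact.out : p.Prime).ne_zero
  have hk : 0 < k := by
    rw [Nat.pos_iff_ne_zero]
    rintro rfl
    have := (Fact.out : p.Prime).one_lt
    omega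
  have hlt : ∀ i : Fin (n + 1), k * (i.1 + 1) < p - 1 := fun i => by
    rw [← hkn]
    exact Nat.mul_lt_mul_of_pos_left (by omega) hk
  have hbig : ∀ i j : Fin (n + 1), n ≤ i.1 + j.1 →
      IsUnit (jacobiSum (ω ^ (k * (i.1 + 1))) (ω ^ (k * (j.1 + 1)))) := fun i j h =>
    isUnit_jacobiSum_pow_of_le_add hω (hlt i) (hlt j) (by
      rw [← hkn, ← mul_add]
      exact Nat.mul_le_mul_left k (by omega))
  have hbig' : ∀ i j : Fin (n + 1), n ≤ i.1 + j.1 → ∃ v : ℤ_[p], IsUnit v ∧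
      ((jacobiSum (ω ^ (k * (i.1 + 1))) (ω ^ (k * (j.1 + 1))) : ℤ_[p]) : ℚ_[p])⁻¹ = v := by
    intro i j h
    obtain ⟨u, hu⟩ := hbig i j h
    refine ⟨_, u⁻¹.isUnit, ?_⟩
    rw [← hu]
    refine inv_eq_of_mul_eq_one_right ?_
    rw [← PadicInt.coe_mul, Units.mul_inv, PadicInt.coe_one]
  have hsmall : ∀ i j : Fin (n + 1), i.1 + j.1 < n → ∃ v : ℤ_[p], IsUnit v ∧ (p : ℚ_[p]) *
      ((jacobiSum (ω ^ (k * (i.1 + 1))) (ω ^ (k * (j.1 + 1))) : ℤ_[p]) : ℚ_[p])⁻¹ = v :=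
    fun i j h => exists_isUnit_natCast_mul_inv_jacobiSum hω (by positivity) (by positivity) (by
      rw [← hkn, ← mul_add]
      exact Nat.mul_lt_mul_of_pos_left (by omega) hk)
  let B := Matrix.of fun i j : Fin (n + 1) =>
    ((jacobiSum (ω ^ (k * (i.1 + 1))) (ω ^ (k * (j.1 + 1))) : ℤ_[p]) : ℚ_[p])⁻¹
  let c : Fin (n + 1) → ℚ_[p] := Fin.snoc (fun _ : Fin n => (p : ℚ_[p])) 1
  have hentry : ∀ i j, ∃ v : ℤ_[p], c i * B i j = v ∧
      (i = Fin.last n → IsUnit v) ∧ (i.1 + j.1 < n → IsUnit v) ∧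
      (i ≠ Fin.last n → n ≤ i.1 + j.1 → PadicInt.toZMod v = 0) := by
    intro i j
    refine Fin.lastCases ?_ (fun i => ?_) i
    · obtain ⟨v, hv, h⟩ := hbig' (Fin.last n) j (by simp)
      exact ⟨v, by simpa [c, B] using h, fun _ => hv, fun _ => hv, fun h => absurd rfl h⟩
    · rcases lt_or_ge (i.castSucc.1 + j.1) n with hij | hij
      · obtain ⟨v, hv, h⟩ := hsmall i.castSucc j hij
        exact ⟨v, by simpa [c, B] using h, fun _ => hv, fun _ => hv, fun _ h => absurd hij h.not_gt⟩
      · obtain ⟨v, hv, h⟩ := hbig' i.castSucc j hij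
        refine ⟨p * v, by simp [c, B, ← h], fun h => absurd h (Fin.castSucc_lt_last i).ne,
          fun h => absurd hij h.not_ge, fun _ _ => by simp⟩
  choose C hC hClast hCunit hCzero using hentry
  have hdet : (p : ℚ_[p]) ^ n * B.det = ((Matrix.of C).det : ℤ_[p]) := by
    have h1 : ∏ i, c i = (p : ℚ_[p]) ^ n := by simp [c, Fin.prod_univ_castSucc]
    rw [← h1, ← Matrix.det_mul_column]
    change _ = PadicInt.Coe.ringHom (Matrix.of C).det
    rw [RingHom.map_det]
    congr 1
    ext i j
    exact hC i j
  have hunit : IsUnit (Matrix.of C).det := by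
    rw [PadicInt.isUnit_iff_toZMod_ne_zero, RingHom.map_det]
    refine Matrix.det_ne_zero_of_antitriangular _
      (fun i j h => hCzero _ _ (Fin.castSucc_lt_last i).ne h)
      (fun i j h => PadicInt.isUnit_iff_toZMod_ne_zero.1 (hCunit _ _ ?_))
      (PadicInt.isUnit_iff_toZMod_ne_zero.1 (hClast _ _ rfl))
    rw [Fin.val_castSucc]
    omega
  have hBne : B.det ≠ 0 := by
    intro h
    rw [h, mul_zero, eq_comm, PadicInt.coe_eq_zero] at hdet
    exact hunit.ne_zero hdet
  have hval := congrArg Padic.valuation hdet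
  rw [Padic.valuation_mul (pow_ne_zero _ hp0) hBne, Padic.valuation_pow, Padic.valuation_p,
    PadicInt.valuation_coe, mul_one] at hval
  have h0 : (Matrix.of C).det.valuation = 0 := by
    have hnorm := PadicInt.isUnit_iff.1 hunit
    rw [PadicInt.norm_eq_zpow_neg_valuation hunit.ne_zero] at hnorm
    have hp1 : (1 : ℝ) < p := mod_cast (Fact.out : p.Prime).one_lt
    rw [zpow_eq_one_iff_right₀ (by positivity) hp1.ne'] at hnorm
    omega
  rw [h0] at hval
  change B.det.valuation = _
  push_cast at hval
  linarith

/-- If `q ∈ ℚ` equals `det B_p(k)`, then the `p`-adic valuation of `q`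
equals `-(n-2)`, where `n = (p-1)/k`. -/
theorem padicValRat_det_Bpk (p : ℕ) [Fact p.Prime] (hp : Odd p)
    (k : ℕ) (hk1 : 1 ≤ k) (hk2 : k < p - 1) (hkd : k ∣ p - 1)
    (χ : MulChar (ZMod p) ℂ)
    (hχ : ∀ ψ : MulChar (ZMod p) ℂ, ∃ m : ℕ, ψ = χ ^ m)
    (q : ℚ)
    (hq : (q : ℂ) =
      Matrix.det (Matrix.of fun i j : Fin ((p - 1) / k - 1) =>
        (∑ x : ZMod p, (χ ^ (k * (i.1 + 1))) x * (χ ^ (k * (j.1 + 1))) (1 - x))⁻¹)) :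
    padicValRat p q = -((((p - 1) / k : ℕ) : ℤ) - 2) := by
  obtain ⟨n, hn⟩ : ∃ n, (p - 1) / k = n + 2 := by
    obtain ⟨d, hd⟩ := hkd
    have hd2 : 2 ≤ d := by
      by_contra! h
      have := Nat.mul_le_mul_left k (Nat.le_of_lt_succ h)
      omega
    exact ⟨d - 2, by rw [hd, Nat.mul_div_cancel_left _ hk1]; omega⟩
  have hkn : k * (n + 2) = p - 1 := by rw [← hn, Nat.mul_div_cancel' hkd]
  rw [hn] at hq ⊢
  obtain ⟨ω, hω⟩ := PadicInt.exists_mulChar_toZMod_eq p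
  let e : ℤ_[p] →+* ℚ_[p] := PadicInt.Coe.ringHom
  have hord : orderOf (ω.ringHomComp e) = p - 1 := by
    rw [← orderOf_of_toZMod_eq hω]
    exact orderOf_injective (MulChar.ringHomCompHom e)
      (MulChar.injective_ringHomComp Subtype.val_injective) ω
  obtain ⟨ψ, f, g, hf, hg⟩ :=
    MulChar.exists_eq_ringHomComp (MulChar.orderOf_eq_of_forall_eq_pow hχ) hord
  let D := Matrix.of fun i j : Fin (n + 1) =>
    (jacobiSum (ψ ^ (k * (i.1 + 1))) (ψ ^ (k * (j.1 + 1))))⁻¹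
  have hD : D.det = q := by
    apply f.injective
    rw [map_ratCast, hq, RingHom.map_det]
    change _ = Matrix.det (Matrix.of fun i j : Fin (n + 1) =>
      (jacobiSum (χ ^ (k * (i.1 + 1))) (χ ^ (k * (j.1 + 1))))⁻¹)
    congr 1
    ext i j
    simp [D, ← hf, MulChar.ringHomComp_pow, jacobiSum_ringHomComp]
  have hq' : (q : ℚ_[p]) = Matrix.det (Matrix.of fun i j : Fin (n + 1) =>
      ((jacobiSum (ω ^ (k * (i.1 + 1))) (ω ^ (k * (j.1 + 1))) : ℤ_[p]) : ℚ_[p])⁻¹) := by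
    rw [← map_ratCast g, ← hD, RingHom.map_det]
    congr 1
    ext i j
    simp only [D, RingHom.mapMatrix_apply, Matrix.map_apply, Matrix.of_apply, map_inv₀,
      ← jacobiSum_ringHomComp, ← MulChar.ringHomComp_pow, hg]
    rw [MulChar.ringHomComp_pow, MulChar.ringHomComp_pow, jacobiSum_ringHomComp]
    rfl
  rw [← Padic.valuation_ratCast, hq', valuation_det_inv_jacobiSum hω hkn]
  push_cast
  ring
end

section
/- det B_p(k) = (−1)^{(n−1)(p+n−1)/2} · p^{−(n−1)} · n^{n−2} · a_p(k), where a_p(k) is the coefficient of t (the degree-one coefficient) in the minimal polynomial P_k(t) over ℚ of θ_k = Σ_{y∈U_k} (ζ_p^y − 1). -/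
open Equiv in
theorem sign_finRevPerm (m : ℕ) :
    Perm.sign (Fin.revPerm : Perm (Fin m)) = (-1) ^ m.choose 2 := by
  induction m with
  | zero => rw [Subsingleton.elim (Fin.revPerm : Perm (Fin 0)) 1]; simp
  | succ m ih =>
    have h : finRotate (m + 1) * Fin.revPerm = Perm.decomposeFin.symm (0, Fin.revPerm) := by
      ext i
      refine Fin.cases ?_ (fun i => ?_) i
      · simp
      · simp [Fin.rev_succ]
    have h' := congrArg Perm.sign h
    rw [Perm.sign_mul, sign_finRotate, Perm.decomposeFin.symm_sign, ih] at h'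
    rw [Nat.choose_succ_succ' m 1, Nat.choose_one_right, pow_add]
    simp only [if_true, one_mul] at h'
    rw [← h', ← mul_assoc, ← pow_add, Nat.succ_sub_one, Even.neg_one_pow ⟨m, rfl⟩, one_mul]

theorem IsPrimitiveRoot.sum_pow_mul {K : Type*} [Field K] {n : ℕ} {η : K}
    (hη : IsPrimitiveRoot η n) (e : ℕ) :
    ∑ l : Fin n, η ^ (e * l.1) = if n ∣ e then (n : K) else 0 := by
  rw [Fin.sum_univ_eq_sum_range fun l => η ^ (e * l)]
  simp_rw [pow_mul]
  split_ifs with h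
  · simp [(hη.pow_eq_one_iff_dvd e).2 h]
  · have h1 : η ^ e ≠ 1 := fun h' => h ((hη.pow_eq_one_iff_dvd e).1 h')
    rw [geom_sum_eq h1, ← pow_mul, mul_comm, pow_mul, hη.pow_eq_one, one_pow, sub_self, zero_div]

open Equiv in
theorem dft_mul_submatrix {K : Type*} [Field K] {m : ℕ} {η : K}
    (hη : IsPrimitiveRoot η (m + 1)) (F : Matrix (Fin (m + 1)) (Fin (m + 1)) K)
    (hF : F = Matrix.of fun i l => η ^ (i.1 * l.1)) :
    F * (F.submatrix (Perm.decomposeFin.symm (0, Fin.revPerm)) id).transpose =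
      ((m : K) + 1) • 1 := by
  ext i j
  have : (F * (F.submatrix (Perm.decomposeFin.symm (0, Fin.revPerm)) id).transpose) i j =
      ∑ l : Fin (m + 1),
        η ^ ((i.1 + (Perm.decomposeFin.symm ((0 : Fin (m + 1)), Fin.revPerm) j).1) * l.1) := by
    simp [Matrix.mul_apply, hF, ← pow_add, add_mul]
  rw [this, hη.sum_pow_mul]
  have key : m + 1 ∣ i.1 + (Perm.decomposeFin.symm ((0 : Fin (m + 1)), Fin.revPerm) j).1 ↔
      i = j := by
    have hi := i.2
    refine Fin.cases ?_ (fun j => ?_) j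
    · simp only [Perm.decomposeFin_symm_apply_zero, Fin.val_zero, add_zero, Fin.ext_iff]
      exact ⟨fun h => Nat.eq_zero_of_dvd_of_lt h hi, fun h => h ▸ dvd_zero _⟩
    · have hj := j.2
      simp only [Perm.decomposeFin_symm_apply_succ, Fin.revPerm_apply, swap_self, refl_apply,
        Fin.val_succ, Fin.val_rev, Fin.ext_iff]
      constructor
      · rintro ⟨c, hc⟩
        have h1 : 0 < c := by
          rcases c with _ | c
          · omega
          · omega
        have h2 : c < 2 := by
          by_contra h
          have := Nat.mul_le_mul_left (m + 1) (not_lt.1 h)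
          omega
        obtain rfl : c = 1 := by omega
        omega
      · intro h
        exact ⟨1, by omega⟩
  simp only [key, Matrix.smul_apply, Matrix.one_apply]
  split_ifs <;> simp

open Equiv in
theorem det_hankel_dft {K : Type*} [Field K] [CharZero K] {m : ℕ} (hm : m ≠ 0) {η : K}
    (hη : IsPrimitiveRoot η (m + 1)) (T : Fin (m + 1) → K) (H : ℕ → K)
    (hH : ∀ e, H e = ∑ l : Fin (m + 1), η ^ (e * l.1) * T l) :
    Matrix.det (Matrix.of fun i j : Fin m => H ((i.1 + 1) + (j.1 + 1))) =
      (-1) ^ m.choose 2 * ((m : K) + 1) ^ (m - 1) *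
        ∑ l, ∏ l' ∈ Finset.univ.erase l, T l' := by
  set F : Matrix (Fin (m + 1)) (Fin (m + 1)) K := Matrix.of fun i l => η ^ (i.1 * l.1) with hF
  set R := F.submatrix (Perm.decomposeFin.symm (0, Fin.revPerm)) id with hR
  have hFR : F * R.transpose = ((m : K) + 1) • 1 := dft_mul_submatrix hη F hF
  have hn : (m : K) + 1 ≠ 0 := by exact_mod_cast Nat.succ_ne_zero m
  have hdet : F.det ^ 2 = (-1) ^ m.choose 2 * ((m : K) + 1) ^ (m + 1) := by
    have h := congrArg Matrix.det hFR
    rw [Matrix.det_mul, Matrix.det_transpose, hR, Matrix.det_permute,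
      Perm.decomposeFin.symm_sign, sign_finRevPerm, Matrix.det_smul, Matrix.det_one] at h
    simp only [if_true, one_mul, Fintype.card_fin, mul_one, Units.val_pow_eq_pow_val,
      Units.val_neg, Units.val_one, Int.cast_pow, Int.cast_neg, Int.cast_one] at h
    rw [← h]
    have h1 : ((-1 : K) ^ m.choose 2) * (-1) ^ m.choose 2 = 1 := by
      rw [← pow_add, Even.neg_one_pow ⟨_, rfl⟩]
    linear_combination (-F.det ^ 2) * h1
  have hadj : ∀ l, ((m : K) + 1) * F.adjugate l 0 = F.det := by
    intro l
    have h : F.adjugate * (F * R.transpose) = F.det • R.transpose := by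
      rw [← Matrix.mul_assoc, Matrix.adjugate_mul, Matrix.smul_mul, Matrix.one_mul]
    rw [hFR, Matrix.mul_smul, Matrix.mul_one] at h
    simpa [hR, hF] using congrFun (congrFun h l) 0
  have hbig : F * Matrix.diagonal T * F.transpose = Matrix.of fun i j => H (i.1 + j.1) := by
    ext i j
    rw [Matrix.mul_apply]
    simp only [Matrix.mul_diagonal, hF, Matrix.of_apply, Matrix.transpose_apply, hH]
    exact Finset.sum_congr rfl fun l _ => by ring
  have hminor : Matrix.det (Matrix.of fun i j : Fin m => H ((i.1 + 1) + (j.1 + 1))) =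
      (F * Matrix.diagonal T * F.transpose).adjugate 0 0 := by
    rw [Matrix.adjugate_fin_succ_eq_det_submatrix, hbig]
    simp only [Fin.val_zero, add_zero, pow_zero, one_mul]
    rfl
  have hexp : (F * Matrix.diagonal T * F.transpose).adjugate 0 0 =
      ∑ l, F.adjugate l 0 ^ 2 * ∏ l' ∈ Finset.univ.erase l, T l' := by
    rw [Matrix.adjugate_mul_distrib, Matrix.adjugate_mul_distrib, Matrix.adjugate_diagonal,
      ← Matrix.adjugate_transpose, ← Matrix.mul_assoc, Matrix.mul_apply]
    simp only [Matrix.mul_diagonal, Matrix.transpose_apply]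
    exact Finset.sum_congr rfl fun l _ => by ring
  rw [hminor, hexp]
  have h2 : ((m : K) + 1) ^ 2 ≠ 0 := pow_ne_zero _ hn
  apply mul_left_cancel₀ h2
  have h3 : ((m : K) + 1) ^ (m + 1) = ((m : K) + 1) ^ 2 * ((m : K) + 1) ^ (m - 1) := by
    rw [← pow_add]; congr 1; omega
  calc _ = ∑ l, F.det ^ 2 * ∏ l' ∈ Finset.univ.erase l, T l' := by
        rw [Finset.mul_sum]
        refine Finset.sum_congr rfl fun l _ => ?_
        rw [← hadj l]; ring
    _ = _ := by rw [← Finset.mul_sum, hdet, h3]; ring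
theorem Polynomial.coeff_one_prod_X_sub_C {R ι : Type*} [CommRing R] [DecidableEq ι]
    (s : Finset ι) (T : ι → R) :
    (∏ l ∈ s, (X - C (T l))).coeff 1 =
      (-1) ^ (s.card - 1) * ∑ l ∈ s, ∏ l' ∈ s.erase l, T l' := by
  have h := congrArg (eval 0) (derivative_prod_finset (s := s) (f := fun l => X - C (T l)))
  rw [← coeff_zero_eq_eval_zero, coeff_derivative] at h
  simp only [zero_add, Nat.cast_zero, mul_one, derivative_X_sub_C, eval_finsetSum,
    eval_prod, eval_sub, eval_X, eval_C, zero_sub] at h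
  rw [h, Finset.mul_sum]
  refine Finset.sum_congr rfl fun l hl => ?_
  rw [Finset.prod_neg, Finset.card_erase_of_mem hl]

theorem minpoly_coeff_one_eq {x : ℂ} (hx : IsIntegral ℚ x) {m : ℕ} (T : Fin (m + 1) → ℂ)
    (hT : Function.Injective T) (hr : (minpoly ℚ x).rootSet ℂ = Set.range T) :
    (((minpoly ℚ x).coeff 1 : ℚ) : ℂ) =
      (-1) ^ m * ∑ l, ∏ l' ∈ Finset.univ.erase l, T l' := by
  have hsep := (minpoly.irreducible hx).separable
  have hmap : (minpoly ℚ x).map (algebraMap ℚ ℂ) = ∏ l, (Polynomial.X - Polynomial.C (T l)) := by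
    have hs := (IsAlgClosed.splits ((minpoly ℚ x).map (algebraMap ℚ ℂ))).eq_prod_roots_of_monic
      ((minpoly.monic hx).map _)
    have hroots : (Polynomial.map (algebraMap ℚ ℂ) (minpoly ℚ x)).roots =
        (Finset.univ.image T).val := by
      have h1 : (Finset.univ.image T) = ((minpoly ℚ x).aroots ℂ).toFinset := by
        apply Finset.coe_injective
        rw [Finset.coe_image, Finset.coe_univ, Set.image_univ, ← hr, Polynomial.rootSet_def]
      rw [h1, Multiset.toFinset_val, Multiset.dedup_eq_self.2]
      exact Polynomial.nodup_roots hsep.map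
    rw [hs, hroots]
    change ∏ r ∈ Finset.univ.image T, _ = _
    rw [Finset.prod_image fun a _ b _ h => hT h]
  have h := congrArg (fun q => q.coeff 1) hmap
  simp only [Polynomial.coeff_map, Polynomial.coeff_one_prod_X_sub_C, Finset.card_univ,
    Fintype.card_fin, Nat.add_sub_cancel] at h
  exact h

open IsCyclotomicExtension in
theorem exists_cyclotomic_lift (p : ℕ) [Fact p.Prime] (L : Type*) [Field L] [Algebra ℚ L]
    [IsCyclotomicExtension {p} ℚ L] {ζ : ℂ} (hζ : IsPrimitiveRoot ζ p)
    (s : Finset (ZMod p)) :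
    ∃ Θ : (ZMod p)ˣ → L,
      (∀ φ : L →ₐ[ℚ] ℂ, ∃ c : (ZMod p)ˣ, ∀ a,
        φ (Θ a) = ∑ y ∈ s, (ζ ^ ((c : ZMod p) * a * y).val - 1)) ∧
      ∀ c : (ZMod p)ˣ, ∃ φ : L →ₐ[ℚ] ℂ, ∀ a,
        φ (Θ a) = ∑ y ∈ s, (ζ ^ ((c : ZMod p) * a * y).val - 1) := by
  have hp : p.Prime := Fact.out
  have hz := zeta_spec p ℚ L
  have key : ∀ (φ : L →ₐ[ℚ] ℂ) (c : ℕ),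
      φ (zeta p ℚ L) = ζ ^ c → ∀ a : (ZMod p)ˣ,
      φ (∑ y ∈ s, (zeta p ℚ L ^ ((a : ZMod p) * y).val - 1)) =
        ∑ y ∈ s, (ζ ^ ((c : ZMod p) * a * y).val - 1) := by
    intro φ c h a
    simp only [map_sum, map_sub, map_pow, map_one, h]
    refine Finset.sum_congr rfl fun y _ => ?_
    congr 1
    rw [← pow_mul]
    refine pow_eq_pow_of_modEq ((ZMod.natCast_eq_natCast_iff _ _ p).1 ?_) hζ.pow_eq_one
    simp [mul_assoc]
  refine ⟨fun a => ∑ y ∈ s, (zeta p ℚ L ^ ((a : ZMod p) * y).val - 1),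
    fun φ => ?_, fun c => ?_⟩
  · have h1 : IsPrimitiveRoot (φ (zeta p ℚ L)) p :=
      hz.map_of_injective φ.injective
    obtain ⟨i, _, hi, hi'⟩ := (hζ.isPrimitiveRoot_iff).1 h1
    refine ⟨ZMod.unitOfCoprime i hi, fun a => ?_⟩
    simpa using key φ i hi'.symm a
  · have hc : IsPrimitiveRoot (ζ ^ (c : ZMod p).val) p :=
      hζ.pow_of_coprime _ (ZMod.val_coe_unit_coprime c)
    let e := hz.embeddingsEquivPrimitiveRoots ℂ (Polynomial.cyclotomic.irreducible_rat hp.pos)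
    refine ⟨e.symm ⟨_, (mem_primitiveRoots hp.pos).2 hc⟩, fun a => ?_⟩
    have h2 : (e.symm ⟨_, (mem_primitiveRoots hp.pos).2 hc⟩) (zeta p ℚ L) =
        ζ ^ (c : ZMod p).val := by
      rw [← hz.embeddingsEquivPrimitiveRoots_apply_coe ℂ
        (Polynomial.cyclotomic.irreducible_rat hp.pos)]
      change ((e (e.symm _)) : ℂ) = _
      rw [Equiv.apply_symm_apply]
    simpa using key _ _ h2 a

theorem galois_of_period (p : ℕ) [Fact p.Prime] {ζ : ℂ} (hζ : IsPrimitiveRoot ζ p)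
    (s : Finset (ZMod p)) (T : (ZMod p)ˣ → ℂ)
    (hT : ∀ c : (ZMod p)ˣ, T c = ∑ y ∈ s, (ζ ^ ((c : ZMod p) * y).val - 1)) :
    IsIntegral ℚ (T 1) ∧ (minpoly ℚ (T 1)).rootSet ℂ = Set.range T ∧
      ∀ a b, T a = T b → ∀ c, T (c * a) = T (c * b) := by
  let L := IntermediateField.adjoin ℚ {ζ}
  have : IsCyclotomicExtension {p} ℚ L := by
    change IsCyclotomicExtension {p} ℚ (IntermediateField.adjoin ℚ {ζ}).toSubalgebra
    rw [IntermediateField.adjoin_simple_toSubalgebra_of_isAlgebraic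
      (hζ.isIntegral (NeZero.pos p)).tower_top.isAlgebraic]
    exact hζ.adjoin_isCyclotomicExtension ℚ
  have : FiniteDimensional ℚ L := IsCyclotomicExtension.finiteDimensional {p} ℚ L
  obtain ⟨Θ, h1, h2⟩ := exists_cyclotomic_lift p L hζ s
  have hT' : ∀ c a : (ZMod p)ˣ,
      T (c * a) = ∑ y ∈ s, (ζ ^ ((c : ZMod p) * a * y).val - 1) := by
    intro c a
    rw [hT, Units.val_mul]
  simp only [← hT'] at h1 h2
  obtain ⟨φ, hφ⟩ := h2 1
  simp only [one_mul] at hφ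
  have hint : ∀ x : L, IsIntegral ℚ x := fun x => Algebra.IsIntegral.isIntegral x
  refine ⟨?_, ?_, fun a b hab c => ?_⟩
  · rw [← hφ 1]
    exact (hint (Θ 1)).map φ
  · rw [← hφ 1, minpoly.algHom_eq φ φ.injective,
      ← Algebra.IsAlgebraic.range_eval_eq_rootSet_minpoly]
    ext x
    constructor
    · rintro ⟨ψ, rfl⟩
      obtain ⟨c, hc⟩ := h1 ψ
      exact ⟨c, by simpa using (hc 1).symm⟩
    · rintro ⟨c, rfl⟩
      obtain ⟨ψ, hψ⟩ := h2 c
      exact ⟨ψ, by simpa using hψ 1⟩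
  · obtain ⟨ψ, hψ⟩ := h2 c
    rw [← hψ, ← hψ, φ.injective ((hφ a).trans (hab.trans (hφ b).symm))]
theorem gaussSum_mul_gaussSum_inv {F : Type*} [Field F] [Fintype F] {A : MulChar F ℂ}
    (hA : A ≠ 1) {ψ : AddChar F ℂ} (hψ : ψ.IsPrimitive) :
    gaussSum A ψ * gaussSum A⁻¹ ψ = A (-1) * Fintype.card F := by
  rw [← mul_gaussSum_inv_eq_gaussSum A⁻¹, mul_left_comm, gaussSum_mul_gaussSum_eq_card hA hψ,
    MulChar.inv_apply', inv_neg_one]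

theorem sum_mulChar_mul_sub_one {F : Type*} [Field F] [Fintype F] {A : MulChar F ℂ}
    (hA : A ≠ 1) (ψ : AddChar F ℂ) :
    ∑ x, A x * (ψ x - 1) = gaussSum A ψ := by
  simp only [mul_sub, Finset.sum_sub_distrib, mul_one, MulChar.sum_eq_zero_of_ne_one hA, sub_zero]
  rfl

theorem sum_one_mulChar_mul_sub_one {F : Type*} [Field F] [Fintype F] {ψ : AddChar F ℂ}
    (hψ : ψ ≠ 1) : ∑ x, (1 : MulChar F ℂ) x * (ψ x - 1) = -Fintype.card F := by
  classical
  have h1 : ∑ x, (1 : MulChar F ℂ) x * (ψ x - 1) = ∑ x, (ψ x - 1) := by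
    refine Finset.sum_congr rfl fun x _ => ?_
    rcases eq_or_ne x 0 with rfl | hx
    · simp
    · rw [MulChar.one_apply hx.isUnit, one_mul]
  rw [h1, Finset.sum_sub_distrib, AddChar.sum_eq_zero_of_ne_one hψ]
  simp

theorem inv_jacobiSum_eq {F : Type*} [Field F] [Fintype F] {A B : MulChar F ℂ}
    (hA : A ≠ 1) {ψ : AddChar F ℂ} (hψ : ψ.IsPrimitive) :
    (jacobiSum A B)⁻¹ =
      (gaussSum A ψ)⁻¹ * ((gaussSum B ψ)⁻¹ * ∑ x, (A * B) x * (ψ x - 1)) := by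
  have hc : (Fintype.card F : ℂ) ≠ 0 := Nat.cast_ne_zero.2 Fintype.card_ne_zero
  by_cases h : A * B = 1
  · obtain rfl : B = A⁻¹ := eq_inv_of_mul_eq_one_right h
    have hψ1 : ψ ≠ 1 := by
      have := hψ one_ne_zero
      rwa [AddChar.mulShift_one] at this
    rw [h, sum_one_mulChar_mul_sub_one hψ1, jacobiSum_nontrivial_inv hA, ← mul_assoc, ← mul_inv,
      gaussSum_mul_gaussSum_inv hA hψ, mul_inv, mul_assoc, mul_neg, inv_mul_cancel₀ hc, inv_neg,
      mul_neg, mul_one]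
  · rw [jacobiSum_eq_gaussSum_mul_gaussSum_div_gaussSum hc h hψ, sum_mulChar_mul_sub_one h]
    rw [inv_div, div_eq_mul_inv, mul_inv]
    ring

theorem prod_gaussSum_sq {F : Type*} [Field F] [Fintype F] {ω : MulChar F ℂ} {m : ℕ}
    (hω : ∀ e, ω ^ e = 1 ↔ m + 1 ∣ e) {ψ : AddChar F ℂ} (hψ : ψ.IsPrimitive) :
    (∏ i : Fin m, gaussSum (ω ^ (i.1 + 1)) ψ) ^ 2 =
      ω (-1) ^ (m + 1).choose 2 * (Fintype.card F : ℂ) ^ m := by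
  have h1 : ∏ i : Fin m, gaussSum (ω ^ (i.1 + 1)) ψ =
      ∏ i : Fin m, gaussSum (ω ^ (i.1 + 1))⁻¹ ψ := by
    rw [← Equiv.prod_comp Fin.revPerm]
    refine Finset.prod_congr rfl fun i _ => ?_
    congr 1
    rw [eq_inv_iff_mul_eq_one, ← pow_add, hω, Fin.revPerm_apply, Fin.val_rev]
    exact ⟨1, by omega⟩
  rw [sq]
  nth_rw 2 [h1]
  rw [← Finset.prod_mul_distrib]
  have h2 : ∀ i : Fin m, gaussSum (ω ^ (i.1 + 1)) ψ * gaussSum (ω ^ (i.1 + 1))⁻¹ ψ =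
      ω (-1) ^ (i.1 + 1) * (Fintype.card F : ℂ) := by
    intro i
    have hi : ω ^ (i.1 + 1) ≠ 1 := fun h => by
      have := Nat.le_of_dvd (Nat.succ_pos _) ((hω _).1 h)
      omega
    rw [gaussSum_mul_gaussSum_inv hi hψ, MulChar.pow_apply' _ (Nat.succ_ne_zero _)]
  rw [Finset.prod_congr rfl fun i _ => h2 i, Finset.prod_mul_distrib, Finset.prod_pow_eq_pow_sum,
    Fin.sum_univ_eq_sum_range (fun i => i + 1), Finset.prod_const, Finset.card_univ,
    Fintype.card_fin]
  congr 2
  have := Finset.sum_range_succ' (fun i => i) m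
  rw [Finset.sum_range_id, Nat.choose_two_right] at *
  omega

theorem MulChar.isPrimitiveRoot_apply_of_generates {F : Type*} [Field F] [Fintype F]
    {χ : MulChar F ℂ} (hχ : ∀ ψ : MulChar F ℂ, ∃ m : ℕ, ψ = χ ^ m) {g : Fˣ}
    (hg : ∀ x, x ∈ Subgroup.zpowers g) :
    IsPrimitiveRoot (χ g) (Fintype.card F - 1) := by
  classical
  have hc : Fintype.card F - 1 ≠ 0 := by
    have := Fintype.one_lt_card (α := F)
    omega
  obtain ⟨ψ, hψ⟩ := MulChar.exists_mulChar_orderOf F (dvd_refl _)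
    (Complex.isPrimitiveRoot_exp _ hc)
  obtain ⟨j, rfl⟩ := hχ ψ
  have key : ∀ d : ℕ, χ g ^ d = 1 → χ ^ d = 1 := by
    intro d hd
    ext u
    obtain ⟨e, rfl⟩ := (Submonoid.mem_powers_iff _ _).1
      ((mem_powers_iff_mem_zpowers).2 (hg u))
    rw [MulChar.pow_apply_coe, MulChar.one_apply_coe, Units.val_pow_eq_pow_val, map_pow,
      ← pow_mul, mul_comm, pow_mul, hd, one_pow]
  refine ⟨?_, fun d hd => ?_⟩
  · rw [← MulChar.pow_apply_coe, ← Fintype.card_units, MulChar.pow_card_eq_one,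
      MulChar.one_apply_coe]
  · rw [← hψ]
    apply orderOf_dvd_of_pow_eq_one
    rw [← pow_mul, mul_comm, pow_mul, key d hd, one_pow]

section Periods

variable {p : ℕ} [Fact p.Prime] {k n : ℕ} {ω : MulChar (ZMod p) ℂ} {g : (ZMod p)ˣ}

theorem sum_pow_mul_periods (hkn : k * n = p - 1) (hn : 0 < n)
    (hg : ∀ x, x ∈ Subgroup.zpowers g)
    (hω : IsPrimitiveRoot (ω g) n) (hωU : ∀ y : ZMod p, y ^ k = 1 → ω y = 1)
    (f : ZMod p → ℂ) (e : ℕ) :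
    ∑ x, (ω ^ e) x * f x =
      ∑ l : Fin n, ω g ^ (e * l.1) *
        ∑ y ∈ Finset.univ.filter (fun y : ZMod p => y ^ k = 1),
          f (((g ^ l.1 : (ZMod p)ˣ) : ZMod p) * y) := by
  classical
  have hp : p.Prime := Fact.out
  have hk : k ≠ 0 := by
    rintro rfl
    have := hp.two_le
    omega
  have hval : ∀ (l : ℕ) (y : ZMod p), y ^ k = 1 →
      ω (((g ^ l : (ZMod p)ˣ) : ZMod p) * y) = ω g ^ l := by
    intro l y hy
    rw [map_mul, hωU y hy, mul_one, Units.val_pow_eq_pow_val, map_pow]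
  have hne : ∀ y : ZMod p, y ^ k = 1 → y ≠ 0 := by
    rintro y hy rfl
    simp [hk] at hy
  have hpow : ∀ x : ZMod p, x ≠ 0 → (ω ^ e) x = ω x ^ e := by
    intro x hx
    obtain ⟨u, rfl⟩ := hx.isUnit
    exact MulChar.pow_apply_coe _ _ _
  have h0 : ∑ x, (ω ^ e) x * f x = ∑ x ∈ Finset.univ.erase 0, (ω ^ e) x * f x := by
    rw [← Finset.add_sum_erase _ _ (Finset.mem_univ (0 : ZMod p)), MulChar.map_zero, zero_mul,
      zero_add]
  rw [h0]
  simp_rw [Finset.mul_sum]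
  rw [← Finset.sum_product']
  symm
  refine Finset.sum_bij (fun q _ => ((g ^ q.1.1 : (ZMod p)ˣ) : ZMod p) * q.2) ?_ ?_ ?_ ?_
  · rintro ⟨l, y⟩ h
    simp only [Finset.mem_product, Finset.mem_filter, Finset.mem_univ, true_and] at h
    simp [hne y h]
  · rintro ⟨l, y⟩ h ⟨l', y'⟩ h' heq
    simp only [Finset.mem_product, Finset.mem_filter, Finset.mem_univ, true_and] at h h' heq
    have h1 := congrArg ω heq
    rw [hval _ _ h, hval _ _ h'] at h1
    obtain rfl : l = l' := Fin.ext (hω.pow_inj l.2 l'.2 h1)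
    rw [Units.mul_right_inj] at heq
    rw [heq]
  · intro x hx
    have hx0 : x ≠ 0 := Finset.ne_of_mem_erase hx
    obtain ⟨u, rfl⟩ := hx0.isUnit
    obtain ⟨r, rfl⟩ := (Submonoid.mem_powers_iff _ _).1
      ((mem_powers_iff_mem_zpowers).2 (hg u))
    refine ⟨(⟨r % n, Nat.mod_lt _ hn⟩, ((g ^ (n * (r / n)) : (ZMod p)ˣ) : ZMod p)), ?_, ?_⟩
    · simp only [Finset.mem_product, Finset.mem_filter, Finset.mem_univ, true_and]
      rw [← Units.val_pow_eq_pow_val, ← pow_mul, mul_comm, ← mul_assoc, hkn, pow_mul,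
        ZMod.units_pow_card_sub_one_eq_one, one_pow, Units.val_one]
    · rw [← Units.val_mul, ← pow_add, Nat.mod_add_div]
  · rintro ⟨l, y⟩ h
    simp only [Finset.mem_product, Finset.mem_filter, Finset.mem_univ, true_and] at h
    rw [hpow _ (by simp [hne y h]), hval _ _ h, ← pow_mul, mul_comm l.1]

theorem range_periods (hkn : k * n = p - 1) (hn : 0 < n)
    (hg : ∀ x, x ∈ Subgroup.zpowers g) (f : ZMod p → ℂ) :
    Set.range (fun c : (ZMod p)ˣ =>
        ∑ y ∈ Finset.univ.filter (fun y : ZMod p => y ^ k = 1), f ((c : ZMod p) * y)) =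
      Set.range (fun l : Fin n =>
        ∑ y ∈ Finset.univ.filter (fun y : ZMod p => y ^ k = 1),
          f (((g ^ l.1 : (ZMod p)ˣ) : ZMod p) * y)) := by
  apply subset_antisymm
  · rintro _ ⟨c, rfl⟩
    obtain ⟨r, rfl⟩ := (Submonoid.mem_powers_iff _ _).1
      ((mem_powers_iff_mem_zpowers).2 (hg c))
    refine ⟨⟨r % n, Nat.mod_lt _ hn⟩, ?_⟩
    have hu : (g ^ (n * (r / n))) ^ k = 1 := by
      rw [← pow_mul, mul_comm, ← mul_assoc, hkn, pow_mul,
        ZMod.units_pow_card_sub_one_eq_one, one_pow]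
    symm
    refine Finset.sum_equiv (Units.mulLeft (g ^ (n * (r / n)))) (fun y => ?_) (fun y _ => ?_)
    · simp only [Finset.mem_filter, Finset.mem_univ, true_and, Units.mulLeft_apply, mul_pow]
      rw [← Units.val_pow_eq_pow_val, hu, Units.val_one, one_mul]
    · rw [Units.mulLeft_apply, ← mul_assoc, ← Units.val_mul, ← pow_add, Nat.mod_add_div]
  · rintro _ ⟨l, rfl⟩
    exact ⟨g ^ l.1, rfl⟩

theorem mulChar_eq_of_periods_eq (hωU : ∀ y : ZMod p, y ^ k = 1 → ω y = 1) (hk : k ≠ 0)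
    {f : ZMod p → ℂ} (hS : ∑ x, ω x * f x ≠ 0) (a b : (ZMod p)ˣ)
    (hab : ∀ c : (ZMod p)ˣ,
      ∑ y ∈ Finset.univ.filter (fun y : ZMod p => y ^ k = 1), f ((c : ZMod p) * a * y) =
      ∑ y ∈ Finset.univ.filter (fun y : ZMod p => y ^ k = 1), f ((c : ZMod p) * b * y)) :
    ω a = ω b := by
  set U := Finset.univ.filter (fun y : ZMod p => y ^ k = 1) with hU
  have h1 : ∀ a : (ZMod p)ˣ, ω a * ∑ c, ω c * ∑ y ∈ U, f (c * a * y) =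
      U.card * ∑ x, ω x * f x := by
    intro a
    rw [← nsmul_eq_mul, ← Finset.sum_const]
    simp_rw [Finset.mul_sum]
    rw [Finset.sum_comm]
    refine Finset.sum_congr rfl fun y hy => ?_
    have hy' : y ^ k = 1 := by simpa [hU] using hy
    have hy0 : y ≠ 0 := by
      rintro rfl
      simp [hk] at hy'
    rw [← Equiv.sum_comp (Units.mulRight (a * Units.mk0 y hy0)) fun x => ω x * f x]
    refine Finset.sum_congr rfl fun c _ => ?_
    simp only [Units.mulRight_apply, Units.val_mul, Units.val_mk0, map_mul, hωU y hy', mul_assoc]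
    ring
  have h2 : ∑ c, ω c * ∑ y ∈ U, f (c * a * y) = ∑ c, ω c * ∑ y ∈ U, f (c * b * y) := by
    refine Finset.sum_congr rfl fun c _ => ?_
    rcases eq_or_ne c 0 with rfl | hc
    · simp
    · rw [show c = (Units.mk0 c hc : ZMod p) from rfl, hab]
  have hU0 : (U.card : ℂ) ≠ 0 :=
    Nat.cast_ne_zero.2 (Finset.card_ne_zero_of_mem (a := 1) (by simp [hU]))
  have ha := h1 a
  rw [h2, ← h1 b] at ha
  refine mul_right_cancel₀ (fun h0 => ?_) ha
  have hb := h1 b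
  rw [h0, mul_zero] at hb
  exact mul_ne_zero hU0 hS hb.symm

end Periods

open Complex in
/-- `det B_p(k) = (-1)^{(n-1)(p+n-1)/2} · p^{-(n-1)} · n^{n-2} · a_p(k)`,
where `n = (p-1)/k` and `a_p(k)` is the coefficient of `t` in the minimal polynomial over
`ℚ` of `θ_k = ∑_{y ∈ U_k} (ζ_p^y - 1)`, `U_k = {y ∈ 𝔽_p : y^k = 1}`, `ζ_p = e^{2πi/p}`. -/
theorem det_Bpk_eq (p : ℕ) [Fact p.Prime] (hp : Odd p)
    (k : ℕ) (hk1 : 1 ≤ k) (hk2 : k < p - 1) (hkd : k ∣ p - 1)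
    (χ : MulChar (ZMod p) ℂ)
    (hχ : ∀ ψ : MulChar (ZMod p) ℂ, ∃ m : ℕ, ψ = χ ^ m)
    (n : ℕ) (hn : n = (p - 1) / k)
    (ζ : ℂ) (hζ : ζ = Complex.exp (2 * Real.pi * Complex.I / p))
    (θ : ℂ)
    (hθ : θ = ∑ y ∈ Finset.univ.filter (fun y : ZMod p => y ^ k = 1), (ζ ^ y.val - 1))
    (a : ℚ) (ha : a = (minpoly ℚ θ).coeff 1) :
    Matrix.det (Matrix.of fun i j : Fin (n - 1) =>
        (∑ x : ZMod p, (χ ^ (k * (i.1 + 1))) x * (χ ^ (k * (j.1 + 1))) (1 - x))⁻¹) =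
      (-1 : ℂ) ^ ((n - 1) * (p + n - 1) / 2) * (p : ℂ) ^ (-(((n - 1 : ℕ) : ℤ))) *
        (n : ℂ) ^ (n - 2) * (a : ℂ) := by
  have hpp : p.Prime := Fact.out
  obtain ⟨r, hr⟩ := hp
  have hk0 : k ≠ 0 := by omega
  have hkn : k * n = p - 1 := by rw [hn, Nat.mul_div_cancel' hkd]
  obtain ⟨m, hm, rfl⟩ : ∃ m, m ≠ 0 ∧ n = m + 1 := by
    have h2 : 2 ≤ n := by
      by_contra h
      have : n ≤ 1 := by omega
      have := Nat.mul_le_mul_left k this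
      omega
    exact ⟨n - 1, by omega, by omega⟩
  clear hn
  have hζp : IsPrimitiveRoot ζ p := hζ ▸ Complex.isPrimitiveRoot_exp p hpp.ne_zero
  have hψ := AddChar.zmodChar_primitive_of_primitive_root p hζp
  set ψ := AddChar.zmodChar p hζp.pow_eq_one with hψdef
  have hψζ : ∀ x, ζ ^ x.val = ψ x := fun x => (AddChar.zmodChar_apply hζp.pow_eq_one x).symm
  obtain ⟨g, hg⟩ := IsCyclic.exists_generator (α := (ZMod p)ˣ)
  have hχg := MulChar.isPrimitiveRoot_apply_of_generates hχ hg
  rw [ZMod.card] at hχg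
  have hlog : ∀ x : ZMod p, x ≠ 0 → ∃ e : ℕ, x = (g : ZMod p) ^ e := by
    intro x hx
    obtain ⟨u, rfl⟩ := hx.isUnit
    obtain ⟨e, rfl⟩ := (Submonoid.mem_powers_iff _ _).1 ((mem_powers_iff_mem_zpowers).2 (hg u))
    exact ⟨e, Units.val_pow_eq_pow_val _ _⟩
  set ω := χ ^ k with hωdef
  have hωχ : ∀ x : ZMod p, ω x = χ x ^ k := fun x => MulChar.pow_apply' χ hk0 x
  have hωg : IsPrimitiveRoot (ω g) (m + 1) := by
    rw [hωχ]
    exact hχg.pow (by have := hpp.two_le; omega) hkn.symm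
  have hωU : ∀ y : ZMod p, y ^ k = 1 → ω y = 1 := by
    intro y hy
    rw [hωχ, ← map_pow, hy, map_one]
  have hω1 : ∀ e, ω ^ e = 1 ↔ m + 1 ∣ e := by
    intro e
    constructor
    · intro h
      rw [← hωg.pow_eq_one_iff_dvd, ← MulChar.pow_apply_coe, h, MulChar.one_apply_coe]
    · rintro ⟨c, rfl⟩
      have h : χ ^ (p - 1) = 1 := by
        have := MulChar.pow_card_eq_one χ
        rwa [ZMod.card_units] at this
      rw [hωdef, ← pow_mul, ← mul_assoc, hkn, pow_mul, h, one_pow]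
  have hω_ne : ∀ i : Fin m, ω ^ (i.1 + 1) ≠ 1 := fun i h => by
    have := Nat.le_of_dvd (Nat.succ_pos _) ((hω1 _).1 h)
    omega
  have hneg : ω (-1) = (-1) ^ k := by
    have hsq : (χ (-1)) ^ 2 = 1 := by rw [← map_pow]; simp
    rw [sq] at hsq
    rcases mul_self_eq_one_iff.1 hsq with h | h
    · exfalso
      obtain ⟨e, he⟩ := hlog (-1) (by simp)
      rw [he, map_pow, hχg.pow_eq_one_iff_dvd] at h
      obtain ⟨c, rfl⟩ := h
      rw [pow_mul, ZMod.pow_card_sub_one_eq_one g.ne_zero, one_pow] at he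
      have : Fact (2 < p) := ⟨by omega⟩
      exact ZMod.neg_one_ne_one he
    · rw [hωχ, h]
  set f : ZMod p → ℂ := fun x => ψ x - 1 with hf
  set P : (ZMod p)ˣ → ℂ := fun c =>
    ∑ y ∈ Finset.univ.filter (fun y : ZMod p => y ^ k = 1), f ((c : ZMod p) * y) with hP
  set T : Fin (m + 1) → ℂ := fun l => P (g ^ l.1) with hT
  have hPζ : ∀ c : (ZMod p)ˣ, P c = ∑ y ∈ Finset.univ.filter (fun y : ZMod p => y ^ k = 1),
      (ζ ^ ((c : ZMod p) * y).val - 1) := by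
    intro c
    simp only [hP, hf, hψζ]
  obtain ⟨hint, hroot, hgal⟩ := galois_of_period p hζp _ P hPζ
  have hθP : θ = P 1 := by rw [hPζ, hθ]; simp
  have hω11 : ω ≠ 1 := by simpa using hω_ne ⟨0, Nat.pos_of_ne_zero hm⟩
  have hS : ∑ x, ω x * f x ≠ 0 := by
    rw [hf, sum_mulChar_mul_sub_one hω11]
    exact gaussSum_ne_zero_of_nontrivial (by simp [hpp.ne_zero]) hω11 hψ
  have hTinj : Function.Injective T := by
    intro l l' hll
    have h := mulChar_eq_of_periods_eq hωU hk0 hS (g ^ l.1) (g ^ l'.1) fun c => by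
      simpa only [hP, Units.val_mul] using hgal _ _ hll c
    rw [Units.val_pow_eq_pow_val, Units.val_pow_eq_pow_val, map_pow, map_pow] at h
    exact Fin.ext (hωg.pow_inj l.2 l'.2 h)
  have ha' : (a : ℂ) = (-1) ^ m * ∑ l, ∏ l' ∈ Finset.univ.erase l, T l' := by
    rw [ha, hθP]
    exact minpoly_coeff_one_eq hint T hTinj
      (hroot.trans (range_periods hkn (Nat.succ_pos m) hg f))
  have hdet := det_hankel_dft hm hωg T (fun e => ∑ x, (ω ^ e) x * f x)
    fun e => sum_pow_mul_periods hkn (Nat.succ_pos m) hg hωg hωU f e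
  have hmat : (Matrix.of fun i j : Fin m =>
        (∑ x : ZMod p, (χ ^ (k * (i.1 + 1))) x * (χ ^ (k * (j.1 + 1))) (1 - x))⁻¹) =
      Matrix.of fun i j : Fin m => (gaussSum (ω ^ (i.1 + 1)) ψ)⁻¹ *
        Matrix.of (fun i j : Fin m => (gaussSum (ω ^ (j.1 + 1)) ψ)⁻¹ *
          Matrix.of (fun i j : Fin m => ∑ x, (ω ^ ((i.1 + 1) + (j.1 + 1))) x * f x) i j) i j := by
    ext i j
    simp only [Matrix.of_apply, pow_mul, ← hωdef, pow_add ω (i.1 + 1)]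
    exact inv_jacobiSum_eq (hω_ne i) hψ
  generalize hm' : m + 1 - 1 = m'
  obtain rfl : m = m' := by omega
  rw [hmat, Matrix.det_mul_column, Matrix.det_mul_row, hdet, Finset.prod_inv_distrib, ha']
  have hprod := prod_gaussSum_sq hω1 hψ
  rw [ZMod.card, hneg, ← pow_mul] at hprod
  have hexp1 : k * (m + 1).choose 2 = r * m := by
    have h1 := Nat.add_one_mul_choose_eq m 1
    rw [Nat.choose_one_right] at h1
    have h2 : k * (m + 1) = 2 * r := by omega
    have h3 : 2 * (k * (m + 1).choose 2) = 2 * (r * m) := by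
      calc _ = k * ((m + 1).choose 2 * 2) := by ring
        _ = (k * (m + 1)) * m := by rw [show (m + 1).choose 2 * 2 = (m + 1) * m from h1.symm]; ring
        _ = _ := by rw [h2]; ring
    omega
  have hexp2 : m * (p + (m + 1) - 1) / 2 = r * m + m + m.choose 2 := by
    have h1 := Nat.add_one_mul_choose_eq m 1
    rw [Nat.choose_one_right] at h1
    have h2 : (m + 1).choose 2 = m + m.choose 2 := by
      rw [Nat.choose_succ_succ' m 1, Nat.choose_one_right]
    have h3 : m * (p + (m + 1) - 1) = 2 * (r * m + m + m.choose 2) := by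
      rw [← Nat.add_assoc, Nat.add_sub_cancel, hr]
      have h4 : (m + 1) * m = (m + 1).choose 2 * 2 := h1
      rw [h2] at h4
      linarith
    omega
  rw [hexp1] at hprod
  rw [hexp2, show m + 1 - 2 = m - 1 by omega, zpow_neg, zpow_natCast,
    ← mul_assoc, ← sq, inv_pow, hprod, mul_inv, ← inv_pow, inv_neg_one, pow_add, pow_add]
  have hs : ((-1 : ℂ) ^ m) * (-1) ^ m = 1 := by
    rw [← pow_add, Even.neg_one_pow ⟨_, rfl⟩]
  push_cast
  linear_combination (-((-1 : ℂ) ^ (r * m) * ((p : ℂ) ^ m)⁻¹ * (-1) ^ m.choose 2 *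
    ((m : ℂ) + 1) ^ (m - 1) * ∑ l, ∏ l' ∈ Finset.univ.erase l, T l')) * hs
end

section
/- The p-adic valuation of the rational number a_p(k) equals 1, where a_p(k) is the coefficient of t in the minimal polynomial over ℚ of θ_k = Σ_{y∈U_k} (ζ_p^y − 1). -/
open Finset

/-- The operator `f ↦ (s ↦ ∑ y ∈ U, (f (s + y) - f s))` on functions on `A`. -/
def sumDiff {A : Type*} [Add A] (R : Type*) [CommRing R] (U : Finset A) :
    Module.End R (A → R) where
  toFun f s := ∑ y ∈ U, (f (s + y) - f s)
  map_add' f g := by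
    ext s
    simp only [Pi.add_apply, ← sum_add_distrib]
    exact sum_congr rfl fun _ _ => by ring
  map_smul' c f := by
    ext s
    simp only [Pi.smul_apply, smul_eq_mul, mul_sum, RingHom.id_apply, mul_sub]

section sumDiff

variable {A : Type*}

theorem sumDiff_apply [Add A] {R : Type*} [CommRing R] (U : Finset A) (f : A → R) (s : A) :
    sumDiff R U f s = ∑ y ∈ U, (f (s + y) - f s) := rfl

theorem sumDiff_pow_comp_ringHom [Add A] {R S : Type*} [CommRing R] [CommRing S] (φ : R →+* S)
    (U : Finset A) (r : ℕ) (f : A → R) :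
    (sumDiff S U ^ r) (φ ∘ f) = φ ∘ (sumDiff R U ^ r) f := by
  induction r with
  | zero => rfl
  | succ r ih =>
    rw [pow_succ', pow_succ', Module.End.mul_apply, Module.End.mul_apply, ih]
    ext s
    simp [sumDiff_apply]

theorem sumDiff_pow_addChar [AddCommGroup A] {R : Type*} [CommRing R] (U : Finset A)
    (ψ : AddChar A R) (r : ℕ) :
    (sumDiff R U ^ r) ψ = (∑ y ∈ U, (ψ y - 1)) ^ r • (ψ : A → R) := by
  have h : sumDiff R U ψ = (∑ y ∈ U, (ψ y - 1)) • (ψ : A → R) := by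
    ext s
    simp only [sumDiff_apply, AddChar.map_add_eq_mul, Pi.smul_apply, smul_eq_mul, sum_mul]
    exact sum_congr rfl fun _ _ => by ring
  induction r with
  | zero => simp
  | succ r ih => rw [pow_succ', Module.End.mul_apply, ih, map_smul, h, smul_smul, pow_succ]

end sumDiff

/-- The sum of the `r`-th powers of the values `∑ y ∈ U, (ψ (t * y) - 1)`. -/
theorem sum_pow_sum_addChar_sub_one {F R : Type*} [CommRing F] [Fintype F] [DecidableEq F]
    [CommRing R] [IsDomain R] {ψ : AddChar F R} (hψ : ψ.IsPrimitive) (U : Finset F) (r : ℕ) :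
    ∑ t : F, (∑ y ∈ U, (ψ (t * y) - 1)) ^ r =
      Fintype.card F * ((sumDiff ℤ U ^ r) (Pi.single 0 1) 0 : ℤ) := by
  have h1 (t : F) : (∑ y ∈ U, (ψ (t * y) - 1)) ^ r =
      (sumDiff R U ^ r) (ψ.mulShift t) 0 := by
    simp [sumDiff_pow_addChar, AddChar.mulShift_apply]
  have h2 : ∑ t : F, (ψ.mulShift t : F → R) =
      (Fintype.card F : R) • (Int.castRingHom R ∘ (Pi.single 0 1 : F → ℤ)) := by
    ext s
    simp only [Finset.sum_apply, AddChar.mulShift_apply, AddChar.sum_mulShift s hψ, Pi.smul_apply,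
      Function.comp_apply, Pi.single_apply]
    split_ifs <;> simp
  simp_rw [h1]
  rw [← Finset.sum_apply, ← map_sum, h2, map_smul, sumDiff_pow_comp_ringHom]
  simp

/-- If `f` is invariant under the `k`-th roots of unity, then its sum over the nonzero elements is
`k` times its sum over coset representatives. -/
theorem sum_erase_zero_eq_mul_sum_range {F R : Type*} [Field F] [Fintype F] [DecidableEq F]
    [CommSemiring R] {g : Fˣ} (hg : ∀ x, x ∈ Subgroup.zpowers g) {k n : ℕ}
    (hn : Fintype.card F - 1 = k * n) {f : F → R}
    (hf : ∀ t y, y ^ k = 1 → f (t * y) = f t) :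
    ∑ t ∈ univ.erase 0, f t = k * ∑ i : Fin n, f ((g : F) ^ (i : ℕ)) := by
  have hcard : Nat.card Fˣ = k * n := by
    rw [Nat.card_eq_fintype_card, Fintype.card_units, hn]
  have hord : orderOf g = k * n := by rw [orderOf_eq_card_of_forall_mem_zpowers hg, hcard]
  have h1 : ∑ t ∈ univ.erase 0, f t = ∑ u : Fˣ, f u := by
    symm
    refine sum_bij (fun u _ => (u : F)) (by simp) (fun _ _ _ _ h => Units.ext h) ?_ (by simp)
    intro t ht
    exact ⟨Units.mk0 t (ne_of_mem_erase ht), by simp⟩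
  have h2 : ∑ u : Fˣ, f u = ∑ j ∈ range (k * n), f ((g : F) ^ j) := by
    rw [← IsCyclic.image_range_card hg, hcard, sum_image]
    · simp
    · rw [← hord, coe_range]
      exact pow_injOn_Iio_orderOf
  have h3 (b : Fin k) (i : Fin n) : f ((g : F) ^ ((i : ℕ) + n * b)) = f ((g : F) ^ (i : ℕ)) := by
    rw [pow_add]
    refine hf _ _ ?_
    rw [← pow_mul, mul_right_comm, mul_comm n k, ← hord, pow_mul, ← Units.val_pow_eq_pow_val,
      pow_orderOf_eq_one]
    simp
  rw [h1, h2, ← Fin.sum_univ_eq_sum_range (fun j => f ((g : F) ^ j)),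
    ← finProdFinEquiv.sum_comp, Fintype.sum_prod_type]
  simp [h3]

section Field

variable {F : Type*} [Field F] [Fintype F] [DecidableEq F] {k : ℕ} [NeZero k]

theorem sum_pow_rootsOfUnity {ω : F} (hω : IsPrimitiveRoot ω k) (j : ℕ) :
    ∑ y with y ^ k = 1, (y : F) ^ j = if k ∣ j then (k : F) else 0 := by
  have hU : univ.filter (fun y : F => y ^ k = 1) = Polynomial.nthRootsFinset k (1 : F) := by
    ext y
    simp [Polynomial.mem_nthRootsFinset (NeZero.pos k)]
  split_ifs with h
  · obtain ⟨m, rfl⟩ := h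
    rw [sum_congr rfl (g := fun _ => (1 : F))]
    · rw [sum_const, hU, hω.card_nthRootsFinset, nsmul_one]
    · intro y hy
      rw [pow_mul, (mem_filter.1 hy).2, one_pow]
  · have hω0 : ω ≠ 0 := hω.ne_zero (NeZero.ne k)
    have : ω ^ j * ∑ y with y ^ k = 1, (y : F) ^ j = ∑ y with y ^ k = 1, (y : F) ^ j := by
      rw [mul_sum]
      refine sum_equiv (Equiv.mulLeft₀ ω hω0) ?_ ?_
      · simp [mul_pow, hω.pow_eq_one]
      · simp [mul_pow]
    have h1 : ω ^ j ≠ 1 := fun h' => h ((hω.pow_eq_one_iff_dvd j).1 h')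
    exact by_contra fun h3 => h1 ((mul_eq_right₀ h3).1 this)

theorem sumDiff_rootsOfUnity_pow {ω : F} (hω : IsPrimitiveRoot ω k) (q : ℕ) :
    sumDiff F (univ.filter fun y : F => y ^ k = 1) (fun s => s ^ (q * k)) =
      ∑ i ∈ range q, (k * (q * k).choose (i * k) : F) • fun s : F => s ^ (i * k) := by
  have hk := NeZero.pos k
  have h (s y : F) : (s + y) ^ (q * k) - s ^ (q * k) =
      ∑ m ∈ range (q * k), s ^ m * y ^ (q * k - m) * (q * k).choose m := by
    rw [add_pow, sum_range_succ]
    simp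
  ext s
  simp only [sumDiff_apply, h, Finset.sum_apply, Pi.smul_apply, smul_eq_mul]
  rw [sum_comm]
  simp only [← sum_mul, ← mul_sum, sum_pow_rootsOfUnity hω]
  symm
  refine sum_of_injOn (· * k) (fun _ _ _ _ => Nat.eq_of_mul_eq_mul_right hk) ?_ ?_ ?_
  · intro i hi
    simpa [hk] using hi
  · intro m hm hm'
    rw [if_neg]
    · simp
    · intro hd
      have hm := mem_range.1 hm
      obtain ⟨i, rfl⟩ : k ∣ m :=
        (Nat.dvd_sub_iff_right hm.le (Dvd.intro_left q rfl)).1 hd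
      refine hm' ⟨i, ?_, mul_comm i k⟩
      rw [mul_comm] at hm
      simpa using Nat.lt_of_mul_lt_mul_right hm
  · intro i hi
    rw [if_pos]
    · ring
    · rw [← Nat.sub_mul]
      exact Dvd.intro_left _ rfl

theorem sumDiff_pow_succ_rootsOfUnity_pow {ω : F} (hω : IsPrimitiveRoot ω k) (r q : ℕ) :
    (sumDiff F (univ.filter fun y : F => y ^ k = 1) ^ (r + 1)) (fun s => s ^ (q * k)) 0 =
      ∑ i ∈ range q, (k * (q * k).choose (i * k) : F) *
        (sumDiff F (univ.filter fun y : F => y ^ k = 1) ^ r) (fun s => s ^ (i * k)) 0 := by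
  rw [pow_succ, Module.End.mul_apply, sumDiff_rootsOfUnity_pow hω, map_sum, Finset.sum_apply]
  simp

theorem sumDiff_pow_rootsOfUnity_pow_of_lt {ω : F} (hω : IsPrimitiveRoot ω k) {r q : ℕ}
    (h : q < r) :
    (sumDiff F (univ.filter fun y : F => y ^ k = 1) ^ r) (fun s => s ^ (q * k)) 0 = 0 := by
  induction r generalizing q with
  | zero => omega
  | succ r ih =>
    rw [sumDiff_pow_succ_rootsOfUnity_pow hω]
    refine sum_eq_zero fun i hi => ?_
    rw [ih (by have := mem_range.1 hi; omega), mul_zero]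

theorem factorial_pow_mul_sumDiff_pow_self {ω : F} (hω : IsPrimitiveRoot ω k) (r : ℕ) :
    (k.factorial : F) ^ r *
      (sumDiff F (univ.filter fun y : F => y ^ k = 1) ^ r) (fun s => s ^ (r * k)) 0 =
      k ^ r * (r * k).factorial := by
  induction r with
  | zero => simp
  | succ r ih =>
    rw [sumDiff_pow_succ_rootsOfUnity_pow hω, sum_range_succ, sum_eq_zero, zero_add]
    · have hc : (((r + 1) * k).choose (r * k) * (r * k).factorial * k.factorial : F) =
          ((r + 1) * k).factorial := by
        have := Nat.add_choose_mul_factorial_mul_factorial (r * k) k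
        rw [← Nat.choose_symm_add] at this
        rw [add_mul, one_mul]
        rw [← Nat.cast_mul, ← Nat.cast_mul, this]
      linear_combination (k.factorial : F) * k * ((r + 1) * k).choose (r * k) * ih + k ^ (r + 1) * hc
    · intro i hi
      rw [sumDiff_pow_rootsOfUnity_pow_of_lt hω (mem_range.1 hi), mul_zero]

theorem factorial_pow_mul_sumDiff_pow_succ {ω : F} (hω : IsPrimitiveRoot ω k) (r : ℕ) :
    (k.factorial : F) ^ r * (2 * k).factorial *
      (sumDiff F (univ.filter fun y : F => y ^ k = 1) ^ r) (fun s => s ^ ((r + 1) * k)) 0 =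
      k ^ r * r * ((r + 1) * k).factorial * k.factorial := by
  induction r with
  | zero => simp [NeZero.ne k]
  | succ r ih =>
    have hb := factorial_pow_mul_sumDiff_pow_self hω r
    rw [sumDiff_pow_succ_rootsOfUnity_pow hω, sum_range_succ, sum_range_succ, sum_eq_zero, zero_add]
    · have hc : (((r + 1 + 1) * k).choose ((r + 1) * k) * ((r + 1) * k).factorial * k.factorial : F) =
          ((r + 1 + 1) * k).factorial := by
        have := Nat.add_choose_mul_factorial_mul_factorial ((r + 1) * k) k
        rw [← Nat.choose_symm_add] at this
        rw [add_mul (r + 1), one_mul]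
        rw [← Nat.cast_mul, ← Nat.cast_mul, this]
      have hc' : (((r + 1 + 1) * k).choose (r * k) * (r * k).factorial * (2 * k).factorial : F) =
          ((r + 1 + 1) * k).factorial := by
        have := Nat.add_choose_mul_factorial_mul_factorial (r * k) (2 * k)
        rw [← Nat.choose_symm_add, ← add_mul] at this
        rw [← Nat.cast_mul, ← Nat.cast_mul, this]
      push_cast
      linear_combination (k.factorial : F) * k * ((r + 1 + 1) * k).choose ((r + 1) * k) * ih +
        (k.factorial : F) * k * ((r + 1 + 1) * k).choose (r * k) * (2 * k).factorial * hb +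
        k ^ (r + 1) * r * (k.factorial : F) * hc + k ^ (r + 1) * (k.factorial : F) * hc'
    · intro i hi
      rw [sumDiff_pow_rootsOfUnity_pow_of_lt hω (mem_range.1 hi), mul_zero]

end Field

section ZMod

variable {p k n : ℕ} [Fact p.Prime] [NeZero k]

theorem sumDiff_pow_single_eq {ω : ZMod p} (hω : IsPrimitiveRoot ω k) (hn : p - 1 = n * k)
    {r : ℕ} (hr : 0 < r) :
    (((sumDiff ℤ (univ.filter fun y : ZMod p => y ^ k = 1) ^ r) (Pi.single 0 1) 0 : ℤ) : ZMod p) =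
      -(sumDiff (ZMod p) (univ.filter fun y : ZMod p => y ^ k = 1) ^ r) (fun s => s ^ (n * k)) 0 := by
  have hδ : (Int.castRingHom (ZMod p) ∘ (Pi.single 0 1 : ZMod p → ℤ)) =
      (fun s => s ^ (0 * k)) - fun s => s ^ (n * k) := by
    ext s
    have hp := (Fact.out : p.Prime).one_lt
    rw [← hn]
    rcases eq_or_ne s 0 with rfl | hs
    · simp [show p - 1 ≠ 0 by omega]
    · simp [hs, ZMod.pow_card_sub_one_eq_one hs]
  have := congrFun (sumDiff_pow_comp_ringHom (Int.castRingHom (ZMod p))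
    (univ.filter fun y : ZMod p => y ^ k = 1) r (Pi.single 0 1)) 0
  rw [hδ, map_sub, Pi.sub_apply, sumDiff_pow_rootsOfUnity_pow_of_lt hω hr, zero_sub] at this
  exact this.symm

theorem natCast_factorial_ne_zero {m : ℕ} (hm : m < p) : (m.factorial : ZMod p) ≠ 0 := by
  rw [Ne, ZMod.natCast_eq_zero_iff, (Fact.out : p.Prime).dvd_factorial]
  omega

theorem natCast_ne_zero_of_lt {m : ℕ} (hm0 : m ≠ 0) (hm : m < p) : (m : ZMod p) ≠ 0 := by
  rw [Ne, ZMod.natCast_eq_zero_iff]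
  exact Nat.not_dvd_of_pos_of_lt (Nat.pos_of_ne_zero hm0) hm

theorem not_dvd_sumDiff_pow_single {ω : ZMod p} (hω : IsPrimitiveRoot ω k) (hn : p - 1 = n * k)
    (hn2 : 2 ≤ n) {r : ℕ} (hr : r = n ∨ r + 1 = n) :
    ¬ (p : ℤ) ∣ (sumDiff ℤ (univ.filter fun y : ZMod p => y ^ k = 1) ^ r) (Pi.single 0 1) 0 := by
  have hp := (Fact.out : p.Prime).one_lt
  have hk := NeZero.pos k
  have hnk : n * k < p := by omega
  have hkp : (k : ZMod p) ≠ 0 := natCast_ne_zero_of_lt hk.ne' (by nlinarith)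
  rw [← ZMod.intCast_zmod_eq_zero_iff_dvd, sumDiff_pow_single_eq hω hn (by omega), neg_eq_zero]
  intro h
  rcases hr with rfl | rfl
  · have := factorial_pow_mul_sumDiff_pow_self hω r
    rw [h, mul_zero] at this
    exact mul_ne_zero (pow_ne_zero _ hkp) (natCast_factorial_ne_zero hnk) this.symm
  · have := factorial_pow_mul_sumDiff_pow_succ hω r
    rw [h, mul_zero] at this
    exact mul_ne_zero (mul_ne_zero (mul_ne_zero (pow_ne_zero _ hkp)
      (natCast_ne_zero_of_lt (by omega) (by nlinarith))) (natCast_factorial_ne_zero hnk))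
      (natCast_factorial_ne_zero (by nlinarith)) this.symm

end ZMod

section Newton

theorem exists_intCast_eq_of_isIntegral {x : ℂ} (hx : IsIntegral ℤ x) {m z : ℤ} (hm : m ≠ 0)
    (h : m * x = z) : ∃ w : ℤ, x = w := by
  have hm' : (m : ℂ) ≠ 0 := by exact_mod_cast hm
  have hq : x = algebraMap ℚ ℂ (z / m) := by
    simp
    field_simp
    rw [mul_comm, h]
  rw [hq, isIntegral_algebraMap_iff (algebraMap ℚ ℂ).injective] at hx
  obtain ⟨w, hw⟩ := IsIntegrallyClosed.isIntegral_iff.1 hx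
  refine ⟨w, ?_⟩
  rw [hq, ← hw]
  simp

/-- If all power sums of algebraic integers are rational integers divisible by a prime `p`, then so
are the elementary symmetric functions of degree less than `p`, and each of these is congruent to
a unit multiple of the corresponding power sum modulo `p ^ 2`. -/
theorem exists_esymm_eq_intCast {σ : Type*} [Fintype σ] {p : ℕ} (hp : p.Prime) {x : σ → ℂ}
    (hx : ∀ i, IsIntegral ℤ (x i)) {P : ℕ → ℤ} (hP : ∀ r, 0 < r → ∑ i, x i ^ r = P r)
    (hpP : ∀ r, 0 < r → (p : ℤ) ∣ P r) (i : ℕ) :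
    ∃ E : ℤ, MvPolynomial.aeval x (MvPolynomial.esymm σ ℤ i) = (E : ℂ) ∧
      (0 < i → i < p → (p : ℤ) ∣ E ∧ ((p : ℤ) ^ 2 ∣ E → (p : ℤ) ^ 2 ∣ P i)) := by
  induction i using Nat.strong_induction_on with
  | _ i ih =>
  rcases Nat.eq_zero_or_pos i with rfl | hi
  · exact ⟨1, by simp, by simp⟩
  choose! E hE hE' using ih
  have hN := congrArg (MvPolynomial.aeval x) (MvPolynomial.mul_esymm_eq_sum σ ℤ i)
  have hS : (i : ℂ) * MvPolynomial.aeval x (MvPolynomial.esymm σ ℤ i) =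
      (((-1) ^ (i + 1) * ∑ a ∈ antidiagonal i with a.1 < i, (-1) ^ a.1 * E a.1 * P a.2 : ℤ) : ℂ) := by
    simp only [map_mul, map_natCast, map_pow, map_neg, map_one, map_sum] at hN
    rw [hN]
    push_cast
    congr 1
    refine sum_congr rfl fun a ha => ?_
    obtain ⟨ha, hai⟩ := mem_filter.1 ha
    have := mem_antidiagonal.1 ha
    rw [hE _ hai, ← hP _ (by omega)]
    simp [MvPolynomial.psum]
  have hint : IsIntegral ℤ (MvPolynomial.aeval x (MvPolynomial.esymm σ ℤ i)) := by
    rw [MvPolynomial.esymm, map_sum]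
    refine IsIntegral.sum _ fun t _ => ?_
    rw [map_prod]
    refine IsIntegral.prod _ fun j _ => ?_
    simpa using hx j
  obtain ⟨e, he⟩ := exists_intCast_eq_of_isIntegral hint (m := i) (by exact_mod_cast hi.ne')
    (by exact_mod_cast hS)
  refine ⟨e, he, fun _ hip => ?_⟩
  have hS' : (i : ℤ) * e =
      (-1) ^ (i + 1) * ∑ a ∈ antidiagonal i with a.1 < i, (-1) ^ a.1 * E a.1 * P a.2 := by
    rw [he] at hS
    exact_mod_cast hS
  have hpi : IsCoprime (p : ℤ) i := by
    rw [Nat.isCoprime_iff_coprime]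
    exact (Nat.coprime_of_lt_prime hi.ne' hip hp)
  have hE0 : E 0 = 1 := by
    have := hE 0 hi
    simp only [MvPolynomial.esymm_zero, map_one] at this
    exact_mod_cast this.symm
  have hmod : (p : ℤ) ^ 2 ∣
      (∑ a ∈ antidiagonal i with a.1 < i, (-1) ^ a.1 * E a.1 * P a.2) - P i := by
    rw [← add_sum_erase _ _ (a := (0, i)) (by simp [hi]), hE0]
    simp only [pow_zero, one_mul, add_sub_cancel_left]
    refine dvd_sum fun a ha => ?_
    obtain ⟨ha0, ha⟩ := mem_erase.1 ha
    obtain ⟨ha, hai⟩ := mem_filter.1 ha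
    have hsum := mem_antidiagonal.1 ha
    have ha1 : 0 < a.1 := by
      rcases Nat.eq_zero_or_pos a.1 with h | h
      · exact absurd (Prod.ext h (by simpa [h] using hsum)) ha0
      · exact h
    rw [mul_assoc, pow_two]
    exact (mul_dvd_mul (hE' _ hai ha1 (by omega)).1 (hpP _ (by omega))).mul_left _
  set S := ∑ a ∈ antidiagonal i with a.1 < i, (-1) ^ a.1 * E a.1 * P a.2
  have hS'' : S = (-1) ^ (i + 1) * (i * e) := by
    rw [hS', ← mul_assoc, ← mul_pow]
    simp
  constructor
  · refine hpi.dvd_of_dvd_mul_left ?_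
    rw [hS']
    have := ((dvd_pow_self _ two_ne_zero).trans hmod)
    have := dvd_add this (hpP i hi)
    rw [sub_add_cancel] at this
    exact this.mul_left _
  · intro h
    rw [hS''] at hmod
    exact (dvd_sub_right ((h.mul_left _).mul_left _)).1 hmod

open Polynomial in
/-- If the elementary symmetric functions of a family of complex numbers are integers satisfying
Eisenstein's criterion, then up to sign they are the coefficients of the minimal polynomial of each
member of the family. -/
theorem minpoly_coeff_eq_of_eisenstein {n p : ℕ} (hn : 0 < n) (hp : p.Prime) {x : Fin n → ℂ}
    {E : ℕ → ℤ} (hE : ∀ i, MvPolynomial.aeval x (MvPolynomial.esymm (Fin n) ℤ i) = (E i : ℂ))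
    (hdvd : ∀ i, 0 < i → i ≤ n → (p : ℤ) ∣ E i) (hndvd : ¬ (p : ℤ) ^ 2 ∣ E n) (i : Fin n)
    {j : ℕ} (hj : j ≤ n) :
    (minpoly ℚ (x i)).coeff j = (-1) ^ (n - j) * E (n - j) := by
  have hcoeff (j : ℕ) (hj : j ≤ n) :
      (∏ i, (X - C (x i))).coeff j = (((-1) ^ (n - j) * E (n - j) : ℤ) : ℂ) := by
    have h := Multiset.prod_X_sub_C_coeff (univ.val.map x) (k := j) (by simpa using hj)
    rw [Multiset.map_map] at h
    simp only [Multiset.card_map, card_val, card_univ, Fintype.card_fin] at h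
    rw [← MvPolynomial.aeval_esymm_eq_multiset_esymm (Fin n) ℤ, hE] at h
    push_cast
    exact h
  have hmonic : (∏ i, (X - C (x i))).Monic := monic_prod_X_sub_C x univ
  have hdeg : (∏ i, (X - C (x i))).natDegree = n := by
    simp
  obtain ⟨q, hq, hqdeg, hqmonic⟩ := lifts_and_natDegree_eq_and_monic
    (f := Int.castRingHom ℂ) (p := ∏ i, (X - C (x i))) (by
      rw [lifts_iff_coeff_lifts]
      intro j
      rcases le_or_gt j n with hj | hj
      · exact ⟨_, (hcoeff j hj).symm⟩
      · rw [coeff_eq_zero_of_natDegree_lt (by rwa [hdeg])]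
        exact ⟨0, by simp⟩) hmonic
  rw [hdeg] at hqdeg
  have hqc (j : ℕ) (hj : j ≤ n) : q.coeff j = (-1) ^ (n - j) * E (n - j) := by
    have := hcoeff j hj
    rw [← hq, Polynomial.coeff_map, eq_intCast] at this
    exact_mod_cast this
  have hpi : Prime (p : ℤ) := Nat.prime_iff_prime_int.1 hp
  have hirr : Irreducible q := by
    refine Polynomial.IsEisensteinAt.irreducible (𝓟 := Ideal.span {(p : ℤ)}) ⟨?_, ?_, ?_⟩
      ((Ideal.span_singleton_prime hpi.ne_zero).2 hpi) hqmonic.isPrimitive (by omega)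
    · rw [hqmonic.leadingCoeff, Ideal.mem_span_singleton]
      exact hpi.not_dvd_one
    · intro j hj
      rw [hqdeg] at hj
      rw [hqc j hj.le, Ideal.mem_span_singleton]
      exact (hdvd _ (by omega) (by omega)).mul_left _
    · rw [hqc 0 (by omega), Ideal.span_singleton_pow, Ideal.mem_span_singleton, Nat.sub_zero,
        IsUnit.dvd_mul_left ((isUnit_one.neg).pow n)]
      exact hndvd
  have hroot : Polynomial.aeval (x i) (q.map (algebraMap ℤ ℚ)) = 0 := by
    rw [Polynomial.aeval_map_algebraMap, Polynomial.aeval_def, ← Polynomial.eval_map]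
    rw [algebraMap_int_eq, hq, Polynomial.eval_prod]
    exact prod_eq_zero (mem_univ i) (by simp)
  rw [← minpoly.eq_of_irreducible_of_monic
    (hqmonic.irreducible_iff_irreducible_map_fraction_map.1 hirr) hroot (hqmonic.map _),
    Polynomial.coeff_map, hqc j hj]
  simp

end Newton

/-- The `p`-adic valuation of `a_p(k)` equals `1`, where `a_p(k)` is the
coefficient of `t` in the minimal polynomial over `ℚ` of
`θ_k = ∑_{y ∈ U_k} (ζ_p^y - 1)`, `U_k = {y ∈ 𝔽_p : y^k = 1}`, `ζ_p = e^{2πi/p}`. -/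
theorem padicValRat_apk (p : ℕ) [Fact p.Prime] (hp : Odd p)
    (k : ℕ) (hk1 : 1 ≤ k) (hk2 : k < p - 1) (hkd : k ∣ p - 1)
    (ζ : ℂ) (hζ : ζ = Complex.exp (2 * Real.pi * Complex.I / p))
    (θ : ℂ)
    (hθ : θ = ∑ y ∈ Finset.univ.filter (fun y : ZMod p => y ^ k = 1), (ζ ^ y.val - 1))
    (a : ℚ) (ha : a = (minpoly ℚ θ).coeff 1) :
    padicValRat p a = 1 := by
  have hpp : p.Prime := Fact.out
  obtain ⟨n, hn⟩ := hkd
  have hn2 : 2 ≤ n := by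
    by_contra h
    interval_cases n <;> omega
  have : NeZero k := ⟨by omega⟩
  obtain ⟨g, hg⟩ := IsCyclic.exists_generator (α := (ZMod p)ˣ)
  have hω : IsPrimitiveRoot ((g : ZMod p) ^ n) k := by
    have h : IsPrimitiveRoot (g : ZMod p) (p - 1) := by
      rw [IsPrimitiveRoot.coe_units_iff, ← ZMod.card_units p, ← Nat.card_eq_fintype_card,
        ← orderOf_eq_card_of_forall_mem_zpowers hg]
      exact IsPrimitiveRoot.orderOf g
    exact h.pow (by omega) (by rw [hn, mul_comm])
  let ψ : AddChar (ZMod p) ℂ := ZMod.stdAddChar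
  have hψ (y : ZMod p) : ψ y = ζ ^ y.val := by
    have h := ZMod.stdAddChar_coe (N := p) y.val
    rw [Int.cast_natCast, Int.cast_natCast, ZMod.natCast_zmod_val] at h
    rw [hζ, ← Complex.exp_nat_mul]
    refine h.trans (congrArg _ ?_)
    ring
  set U := univ.filter fun y : ZMod p => y ^ k = 1
  let f (t : ZMod p) : ℂ := ∑ y ∈ U, (ψ (t * y) - 1)
  have hf (t y : ZMod p) (hy : y ^ k = 1) : f (t * y) = f t := by
    have hy0 : y ≠ 0 := by
      rintro rfl
      simp [NeZero.ne k] at hy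
    refine sum_equiv (Equiv.mulLeft₀ y hy0) ?_ ?_
    · simp [U, mul_pow, hy]
    · simp [mul_assoc]
  have hint (t : ZMod p) : IsIntegral ℤ (f t) := by
    refine IsIntegral.sum _ fun y _ => IsIntegral.sub ?_ isIntegral_one
    refine IsIntegral.of_pow hpp.pos ?_
    rw [← AddChar.map_nsmul_eq_pow]
    simpa using isIntegral_one
  let x (i : Fin n) : ℂ := f ((g : ZMod p) ^ (i : ℕ))
  let N (r : ℕ) : ℤ := (sumDiff ℤ U ^ r) (Pi.single 0 1) 0
  have hsum (r : ℕ) (hr : 0 < r) : (k : ℂ) * ∑ i, x i ^ r = p * N r := by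
    have h := sum_pow_sum_addChar_sub_one (ZMod.isPrimitive_stdAddChar p) U r
    rw [ZMod.card, ← add_sum_erase _ _ (mem_univ 0)] at h
    simp only [zero_mul, AddChar.map_zero_eq_one, sub_self, sum_const_zero, zero_pow hr.ne',
      zero_add] at h
    rw [← h, ← sum_erase_zero_eq_mul_sum_range hg (f := fun t => f t ^ r) (by rw [ZMod.card, hn])
      fun t y hy => by rw [hf t y hy]]
  have hP (r : ℕ) : ∃ P : ℤ, 0 < r → ∑ i, x i ^ r = P := by
    rcases Nat.eq_zero_or_pos r with rfl | hr
    · simp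
    · obtain ⟨P, hP⟩ := exists_intCast_eq_of_isIntegral (x := ∑ i, x i ^ r) (m := k) (z := p * N r)
        (IsIntegral.sum _ fun i _ => (hint _).pow r) (by exact_mod_cast NeZero.ne k)
        (by exact_mod_cast hsum r hr)
      exact ⟨P, fun _ => hP⟩
  choose P hP using hP
  have hkP (r : ℕ) (hr : 0 < r) : (k : ℤ) * P r = p * N r := by
    have := hsum r hr
    rw [hP r hr] at this
    exact_mod_cast this
  have hpk : IsCoprime (p : ℤ) k := by
    rw [Nat.isCoprime_iff_coprime]
    exact Nat.coprime_of_lt_prime (by omega) (by omega) hpp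
  have hpP (r : ℕ) (hr : 0 < r) : (p : ℤ) ∣ P r :=
    hpk.dvd_of_dvd_mul_left ⟨_, hkP r hr⟩
  have hp0 : (p : ℤ) ≠ 0 := by exact_mod_cast hpp.ne_zero
  have hnP (r : ℕ) (hr : r = n ∨ r + 1 = n) : ¬ (p : ℤ) ^ 2 ∣ P r := by
    intro h
    refine not_dvd_sumDiff_pow_single hω (by rw [hn, mul_comm]) hn2 hr ?_
    have := h.mul_left (k : ℤ)
    rw [hkP r (by omega), pow_two] at this
    exact (mul_dvd_mul_iff_left hp0).1 this
  choose E hE hE' using exists_esymm_eq_intCast hpp (fun i => hint _) hP hpP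
  have hnp : n < p := by
    have : n ≤ k * n := Nat.le_mul_of_pos_left n hk1
    omega
  have hθx : θ = x ⟨0, by omega⟩ := by
    simp [hθ, x, f, hψ]
  rw [hθx, minpoly_coeff_eq_of_eisenstein (by omega) hpp hE
    (fun i hi hin => (hE' i hi (by omega)).1)
    (fun h => hnP n (.inl rfl) ((hE' n (by omega) hnp).2 h)) _ (by omega)] at ha
  obtain ⟨⟨e, he⟩, h2⟩ := hE' (n - 1) (by omega) (by omega)
  have hpe : ¬ (p : ℤ) ∣ e := fun h => hnP (n - 1) (.inr (by omega)) (h2 (by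
    rw [he, pow_two]
    exact mul_dvd_mul_left _ h))
  have he0 : e ≠ 0 := fun h => hpe (h ▸ dvd_zero _)
  have ha' : a = ((p * ((-1) ^ (n - 1) * e) : ℤ) : ℚ) := by
    rw [ha, he]
    push_cast
    ring
  rw [ha', padicValRat.of_int, padicValInt.mul hp0 (by simp [he0]), padicValInt.self hpp.one_lt,
    padicValInt.eq_zero_of_not_dvd]
  · simp
  · rwa [IsUnit.dvd_mul_left ((isUnit_one.neg).pow _)]
end

section
/- Let n ≥ 2 be an integer and let s be an integer with gcd(s,n)=1. Let τ_s be the permutation of the set of nonzero residues ℤ/nℤ∖{0} sending x to s·x. Then the sign of τ_s equals: the Jacobi symbol (s/n) if n is odd; 1 if n ≡ 2 (mod 4); and (−1)^{(s−1)/2} if n ≡ 0 (mod 4). -/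
open Equiv Equiv.Perm

theorem ZMod.exists_perm_eq_intCast_mul {n : ℕ} {s : ℤ} (hs : Int.gcd s n = 1) :
    ∃ f : Perm (ZMod n), ∀ x, f x = (s : ZMod n) * x := by
  obtain ⟨u, hu⟩ :=
    (ZMod.coe_int_isUnit_iff_isCoprime s n).2 (Int.isCoprime_iff_gcd_eq_one.2 hs).symm
  exact ⟨u.mulLeft, fun x => by simp [hu]⟩

theorem ZMod.sign_addRight_of_odd {n : ℕ} [NeZero n] (hn : Odd n) (c : ZMod n) :
    sign (Equiv.addRight c) = 1 := by
  have h : (Equiv.addRight c) ^ n = 1 := by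
    ext x
    simp
  have h' := congrArg sign h
  rw [map_pow, map_one] at h'
  rcases Int.units_eq_one_or (sign (Equiv.addRight c)) with h1 | h1
  · exact h1
  · rw [h1, hn.neg_one_pow] at h'
    exact h1.trans h'

theorem ZMod.sign_addRight_two (k : ℤ) :
    sign (Equiv.addRight (k : ZMod 2)) = (-1) ^ k := by
  rcases Int.even_or_odd k with h | h
  · rw [(ZMod.intCast_eq_zero_iff_even).2 h, h.neg_one_zpow]
    decide
  · rw [(ZMod.intCast_eq_one_iff_odd).2 h, h.neg_one_zpow]
    decide

/-- The carry out of the lowest digit when a two-digit number in base `b` with lowest digit `r` is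
multiplied by `s`. -/
def ZMod.mulCarry (b : ℕ) (s : ℤ) (r : ZMod b) : ℤ := s * r.val / b

theorem ZMod.mul_val_eq {b : ℕ} [NeZero b] (s : ℤ) (r : ZMod b) :
    s * r.val = ((s : ZMod b) * r).val + b * ZMod.mulCarry b s r := by
  have h : (((s : ZMod b) * r).val : ℤ) = s * r.val % b := by
    rw [← ZMod.val_intCast]
    simp
  rw [h, ZMod.mulCarry, Int.emod_add_mul_ediv]

theorem ZMod.sign_eq_prod_mulCarry {a b : ℕ} [NeZero a] [NeZero b] [NeZero (a * b)] {s : ℤ}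
    {f : Perm (ZMod (a * b))} {fa : Perm (ZMod a)} {fb : Perm (ZMod b)}
    (hf : ∀ x, f x = s * x) (hfa : ∀ x, fa x = s * x) (hfb : ∀ x, fb x = s * x) :
    sign f = (∏ r : ZMod b, sign (Equiv.addRight (ZMod.mulCarry b s r : ZMod a))) *
      sign fa ^ b * sign fb ^ a := by
  let e : ZMod b × ZMod a → ZMod (a * b) := fun x => ((x.1.val + b * x.2.val : ℕ) : ZMod (a * b))
  have he : Function.Bijective e := by
    rw [Fintype.bijective_iff_injective_and_card]
    refine ⟨?_, by simp [ZMod.card, mul_comm]⟩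
    rintro ⟨r, q⟩ ⟨r', q'⟩ h
    have hlt : ∀ (r : ZMod b) (q : ZMod a), r.val + b * q.val < a * b := fun r q => by
      have h1 := r.val_lt
      have h2 := q.val_lt
      nlinarith
    have h1 : r.val + b * q.val = r'.val + b * q'.val := by
      have := (ZMod.natCast_eq_natCast_iff' _ _ _).1 h
      rwa [Nat.mod_eq_of_lt (hlt _ _), Nat.mod_eq_of_lt (hlt _ _)] at this
    have h2 : r.val = r'.val := by
      have := congrArg (· % b) h1
      simpa [Nat.mod_eq_of_lt r.val_lt, Nat.mod_eq_of_lt r'.val_lt] using this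
    have h3 : q.val = q'.val := by
      rw [h2] at h1
      exact Nat.eq_of_mul_eq_mul_left (NeZero.pos b) (Nat.add_left_cancel h1)
    rw [ZMod.val_injective b h2, ZMod.val_injective a h3]
  have hb : ∀ y : ℤ, (b : ZMod (a * b)) * (((y : ZMod a).val : ℕ) : ZMod (a * b)) = b * y := by
    intro y
    have h := ZMod.val_intCast (n := a) y
    have h2 : ((b * (y % a : ℤ) : ℤ) : ZMod (a * b)) = ((b * y : ℤ) : ZMod (a * b)) := by
      rw [ZMod.intCast_eq_intCast_iff_dvd_sub, Int.emod_def]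
      exact ⟨y / a, by push_cast; ring⟩
    rw [← h] at h2
    exact_mod_cast h2
  let g : Perm (ZMod b × ZMod a) :=
    (prodCongrRight fun r => fa.trans (Equiv.addRight (ZMod.mulCarry b s r : ZMod a))).trans
      (prodCongrLeft fun _ => fb)
  have hg : sign f = sign g := by
    symm
    refine sign_eq_sign_of_equiv g f (Equiv.ofBijective e he) ?_
    rintro ⟨r, q⟩
    have h1 : g (r, q) = ((s : ZMod b) * r,
        ((s * q.val + ZMod.mulCarry b s r : ℤ) : ZMod a)) := by
      simp [g, hfa, hfb]
    have h2 := congrArg (Int.cast : ℤ → ZMod (a * b)) (ZMod.mul_val_eq s r)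
    push_cast at h2
    simp only [Equiv.ofBijective_apply, h1, e, hf]
    push_cast [hb]
    rw [mul_add, h2]
    have := hb (s * q.val + ZMod.mulCarry b s r)
    push_cast at this
    rw [this]
    ring
  rw [hg, sign_trans, sign_prodCongrRight, sign_prodCongrLeft]
  simp only [sign_trans, Finset.prod_mul_distrib, Finset.prod_const, Finset.card_univ, ZMod.card]
  rw [mul_comm]

theorem ZMod.sign_mul_prime {p : ℕ} [Fact p.Prime] (hp : Odd p) {s : ℤ}
    {f : Perm (ZMod p)} (hf : ∀ x, f x = s * x) : (sign f : ℤ) = legendreSym p s := by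
  obtain ⟨m, rfl⟩ : ∃ m, p = m + 1 := ⟨p - 1, by have := hp.pos; omega⟩
  have hs : (s : ZMod (m + 1)) ≠ 0 := by
    intro h0
    have h01 : f 0 = f 1 := by rw [hf, hf, h0]; simp
    exact zero_ne_one (f.injective h01)
  let d : Fin (m + 1) → Fin (m + 1) → ZMod (m + 1) := fun i j =>
    (show ZMod (m + 1) from i) - (show ZMod (m + 1) from j)
  let g : Perm (Fin (m + 1)) := f
  have hfg : sign f = sign g := rfl
  have hd := g.prod_Iio_comp_eq_sign_mul_prod (f := d) fun i j =>
    (neg_sub (show ZMod (m + 1) from j) (show ZMod (m + 1) from i)).symm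
  have h1 : ∀ i j : Fin (m + 1), d (g i) (g j) = s * d i j := fun i j =>
    (congrArg₂ (· - ·) (hf i) (hf j)).trans (mul_sub _ _ _).symm
  have h2 : ∏ j, ∏ i ∈ Finset.Iio j, d i j ≠ 0 := by
    refine Finset.prod_ne_zero_iff.2 fun j _ => Finset.prod_ne_zero_iff.2 fun i hi => ?_
    exact sub_ne_zero.2 (Finset.mem_Iio.1 hi).ne
  simp only [h1, Finset.prod_mul_distrib, Finset.prod_const, Fin.card_Iio] at hd
  replace hd := mul_right_cancel₀ h2 hd
  have h3 : ∑ j : Fin (m + 1), (j : ℕ) = (m + 1) * ((m + 1) / 2) := by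
    rw [Fin.sum_univ_eq_sum_range (fun i => i)]
    have := Finset.sum_range_id_mul_two (m + 1)
    obtain ⟨k, hk⟩ := hp
    have h4 : (m + 1) / 2 = k := by omega
    have h5 : m + 1 - 1 = k * 2 := by omega
    rw [h5, ← mul_assoc] at this
    rw [h4]
    exact Nat.eq_of_mul_eq_mul_right two_pos this
  rw [Finset.prod_pow_eq_pow_sum, h3, pow_mul, ZMod.pow_card, ← legendreSym.eq_pow] at hd
  have h2 : (2 : ZMod (m + 1)) ≠ 0 := by
    refine Ring.two_ne_zero ?_
    rw [ZMod.ringChar_zmod_n]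
    rintro h
    rw [h] at hp
    exact absurd hp (by decide)
  have h1' : (-1 : ZMod (m + 1)) ≠ 1 := fun h => h2 (by linear_combination -h)
  rw [hfg]
  rcases Int.units_eq_one_or (sign g) with h | h <;>
    rcases legendreSym.eq_one_or_neg_one (m + 1) hs with h' | h'
  · simp [h, h']
  · exact absurd (by simpa [h, h'] using hd) h1'
  · exact absurd (by simpa [h, h'] using hd.symm) h1'
  · simp [h, h']

theorem ZMod.sign_mul_odd {n : ℕ} [hn0 : NeZero n] (hn : Odd n) {s : ℤ} (hs : Int.gcd s n = 1)
    {f : Perm (ZMod n)} (hf : ∀ x, f x = s * x) : (sign f : ℤ) = jacobiSym s n := by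
  revert hn0 hn hs f
  induction n using Nat.recOnMul with
  | zero =>
    intro h
    exact absurd rfl h.out
  | one =>
    intro _ hn hs f hf
    have : f = 1 := Subsingleton.elim _ _
    simp [this]
  | prime p hp =>
    intro _ hn hs f hf
    have := Fact.mk hp
    convert ZMod.sign_mul_prime hn hf using 1
    exact (jacobiSym.legendreSym.to_jacobiSym p s).symm
  | mul a b iha ihb =>
    intro _ hn hs f hf
    have hab : a * b ≠ 0 := NeZero.ne _
    have : NeZero a := ⟨left_ne_zero_of_mul hab⟩
    have : NeZero b := ⟨right_ne_zero_of_mul hab⟩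
    obtain ⟨ha, hb⟩ := Nat.odd_mul.1 hn
    have hsa : Int.gcd s a = 1 := by
      rw [← Int.isCoprime_iff_gcd_eq_one] at hs ⊢
      push_cast at hs
      exact hs.of_mul_right_left
    have hsb : Int.gcd s b = 1 := by
      rw [← Int.isCoprime_iff_gcd_eq_one] at hs ⊢
      push_cast at hs
      exact hs.of_mul_right_right
    obtain ⟨fa, hfa⟩ := ZMod.exists_perm_eq_intCast_mul hsa
    obtain ⟨fb, hfb⟩ := ZMod.exists_perm_eq_intCast_mul hsb
    have hodd : ∀ (u : ℤˣ) {k : ℕ}, Odd k → u ^ k = u := fun u k hk => by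
      rcases Int.units_eq_one_or u with rfl | rfl
      · simp
      · exact hk.neg_one_pow
    have h := ZMod.sign_eq_prod_mulCarry hf hfa hfb
    simp only [ZMod.sign_addRight_of_odd ha, Finset.prod_const_one, one_mul, hodd _ ha,
      hodd _ hb] at h
    rw [jacobiSym.mul_right, ← iha ha hsa hfa, ← ihb hb hsb hfb]
    rw [← Units.val_mul, ← h]

theorem ZMod.two_mul_sum_mulCarry {b : ℕ} [NeZero b] {s : ℤ} (hs : Int.gcd s b = 1) :
    2 * ∑ r : ZMod b, ZMod.mulCarry b s r = (s - 1) * (b - 1) := by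
  obtain ⟨f, hf⟩ := ZMod.exists_perm_eq_intCast_mul hs
  have h1 : s * ∑ r : ZMod b, (r.val : ℤ) =
      ∑ r : ZMod b, (r.val : ℤ) + b * ∑ r : ZMod b, ZMod.mulCarry b s r := by
    rw [← Equiv.sum_comp f fun r : ZMod b => (r.val : ℤ), Finset.mul_sum, Finset.mul_sum,
      Equiv.sum_comp f fun r : ZMod b => s * (r.val : ℤ), ← Finset.sum_add_distrib]
    exact Finset.sum_congr rfl fun r _ => by rw [hf, ZMod.mul_val_eq]
  have h2 : (∑ r : ZMod b, (r.val : ℤ)) * 2 = b * (b - 1) := by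
    obtain ⟨m, rfl⟩ := Nat.exists_eq_succ_of_ne_zero (NeZero.ne b)
    have h3 : ∑ r : ZMod (m + 1), r.val = ∑ i ∈ Finset.range (m + 1), i :=
      Fin.sum_univ_eq_sum_range (fun i => i) (m + 1)
    have h4 := Finset.sum_range_id_mul_two (m + 1)
    rw [← h3] at h4
    have h5 := congrArg (Nat.cast : ℕ → ℤ) h4
    push_cast at h5
    simpa using h5
  have hb : (b : ℤ) ≠ 0 := by exact_mod_cast NeZero.ne b
  apply mul_left_cancel₀ hb
  linear_combination (-2) * h1 + (s - 1) * h2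

theorem ZMod.sign_mul_two_mul {b : ℕ} [NeZero b] [NeZero (2 * b)] {s : ℤ}
    (hs : Int.gcd s (2 * b : ℕ) = 1) {f : Perm (ZMod (2 * b))} (hf : ∀ x, f x = s * x) :
    sign f = (-1) ^ ((s - 1) / 2 * (b - 1)) := by
  have hs' := hs
  rw [← Int.isCoprime_iff_gcd_eq_one] at hs'
  push_cast at hs'
  have hsb : Int.gcd s b = 1 := Int.isCoprime_iff_gcd_eq_one.1 hs'.of_mul_right_right
  have hs2 : Odd s := Int.isCoprime_two_right.1 hs'.of_mul_right_left
  obtain ⟨fb, hfb⟩ := ZMod.exists_perm_eq_intCast_mul hsb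
  have h2 : ∀ x : ZMod 2, (1 : Perm (ZMod 2)) x = s * x := fun x => by
    simp [ZMod.intCast_eq_one_iff_odd.2 hs2]
  rw [ZMod.sign_eq_prod_mulCarry hf h2 hfb, Int.units_sq, Perm.sign_one, one_pow, mul_one, mul_one]
  simp only [ZMod.sign_addRight_two]
  have hsum : ∀ t : Finset (ZMod b), ∏ r ∈ t, (-1 : ℤˣ) ^ ZMod.mulCarry b s r =
      (-1) ^ ∑ r ∈ t, ZMod.mulCarry b s r := fun t => by
    induction t using Finset.cons_induction with
    | empty => simp
    | cons r t hr ih => rw [Finset.prod_cons, Finset.sum_cons, ih, zpow_add]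
  rw [hsum]
  congr 1
  have := ZMod.two_mul_sum_mulCarry hsb
  obtain ⟨k, rfl⟩ := hs2
  have hk : (2 * k + 1 - 1) / 2 = k := by omega
  rw [hk]
  linarith


/-- Let `n ≥ 2` and `s ∈ ℤ` with `gcd(s,n) = 1`. Let `τ_s` be the
permutation of the nonzero residues of `ℤ/nℤ` sending `x` to `s·x`. Then
`sign(τ_s)` is the Jacobi symbol `(s/n)` if `n` is odd, `1` if `n ≡ 2 (mod 4)`, and
`(-1)^{(s-1)/2}` if `n ≡ 0 (mod 4)`. -/
theorem sign_mul_perm (n : ℕ) [NeZero n] (hn : 2 ≤ n) (s : ℤ) (hs : Int.gcd s n = 1)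
    (τ : Equiv.Perm {x : ZMod n // x ≠ 0})
    (hτ : ∀ x : {x : ZMod n // x ≠ 0}, (τ x : ZMod n) = (s : ZMod n) * (x : ZMod n)) :
    (Equiv.Perm.sign τ : ℤ) =
      if Odd n then jacobiSym s n
      else if n % 4 = 2 then 1
      else (((-1 : ℤˣ) ^ ((s - 1) / 2) : ℤˣ) : ℤ) := by
  obtain ⟨f, hf⟩ := ZMod.exists_perm_eq_intCast_mul hs
  have hf0 : f 0 = 0 := by simp [hf]
  have hsign : sign τ = sign f := by
    have h₁ : ∀ x, f x ≠ 0 ↔ x ≠ 0 := fun x => by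
      rw [not_iff_not, ← f.injective.eq_iff (a := x) (b := 0), hf0]
    rw [← Equiv.Perm.sign_subtypePerm f (p := fun x => x ≠ 0) h₁
      (fun x hx h0 => hx (by rw [h0, hf0]))]
    congr 1
    ext x
    simp [hτ, hf]
  rw [hsign]
  split_ifs with hodd h2
  · exact ZMod.sign_mul_odd hodd hs hf
  all_goals
    obtain ⟨b, rfl⟩ := (Nat.not_odd_iff_even.1 hodd).exists_two_nsmul
    rw [smul_eq_mul] at *
    have : NeZero b := ⟨by omega⟩
    rw [ZMod.sign_mul_two_mul hs hf, mul_comm, zpow_mul]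
  · have : Even ((b : ℤ) - 1) := by rw [Int.even_iff]; omega
    simp [this.neg_one_zpow]
  · have : Odd ((b : ℤ) - 1) := by rw [Int.odd_iff]; omega
    rw [this.neg_one_zpow]
end
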